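/- arXiv:2206.00514 — 2 statements merged into one kernel-verified Lean document; each statement's English description precedes it below -/
import Mathlib

section
/- Under Assumption (A) and assuming C^{−1} ≤ A_{kk}² ≤ C for all k for a constant C ≥ 1 independent of n, one has max_{1 ≤ i ≤ p−1} max_{1 ≤ k ≤ n} E[(p_{i,kk} − E[p_{i,kk}])²] = O(1/n) as n → ∞; that is, the variances of the diagonal entries of the projection matrices P_i are at most of order 1/n, uniformly in i and k. -/
open MeasureTheory ProbabilityTheory Matrix Filter Topology

noncomputable section

/-- The standard Gaussian measure on `ℝ^d` (modeled on `Fin d → ℝ`). -/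
def gaussianPi (d : ℕ) : Measure (Fin d → ℝ) :=
  Measure.pi fun _ => gaussianReal 0 1

/-- The Euclidean norm on `Fin n → ℝ`. -/
def euclidNorm {n : ℕ} (x : Fin n → ℝ) : ℝ :=
  Real.sqrt (∑ j, x j ^ 2)

/-- The uniform distribution on the unit sphere `S^{n-1} ⊆ ℝ^n`, realized as the law of a
normalized standard Gaussian vector. -/
def uniformSphere (n : ℕ) : Measure (Fin n → ℝ) :=
  (gaussianPi n).map fun x => (euclidNorm x)⁻¹ • x

/-- The joint law of `p` independent uniform random directions `u_1, …, u_p` on `S^{n-1}`. -/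
def sphereLaw (n p : ℕ) : Measure (Fin p → Fin n → ℝ) :=
  Measure.pi fun _ => uniformSphere n

/-- The `(i+1)`-st sample vector `u_{i+1}` (junk value `0` if `i ≥ p`). -/
def uVec {n p : ℕ} (ω : Fin p → Fin n → ℝ) (i : ℕ) : Fin n → ℝ :=
  if h : i < p then ω ⟨i, h⟩ else 0

/-- The matrix `B_{(i)} = (b_1, …, b_i)ᵀ` with rows `b_j = A u_j`. -/
def rowMat {n p : ℕ} (A : Matrix (Fin n) (Fin n) ℝ) (ω : Fin p → Fin n → ℝ) (i : ℕ) :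
    Matrix (Fin i) (Fin n) ℝ :=
  Matrix.of fun k j => A.mulVec (uVec ω (k : ℕ)) j

/-- The projection matrix `P_i = I_n − B_{(i)}ᵀ (B_{(i)} B_{(i)}ᵀ)⁻¹ B_{(i)}` (with `P_0 = I_n`). -/
def projMat {n p : ℕ} (A : Matrix (Fin n) (Fin n) ℝ) (ω : Fin p → Fin n → ℝ) (i : ℕ) :
    Matrix (Fin n) (Fin n) ℝ :=
  1 - (rowMat A ω i)ᵀ * (rowMat A ω i * (rowMat A ω i)ᵀ)⁻¹ * rowMat A ω i

/-- The entrywise expectation `E[P_i]` of the projection matrix `P_i`. -/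
def meanProj (n p : ℕ) (A : Matrix (Fin n) (Fin n) ℝ) (i : ℕ) :
    Matrix (Fin n) (Fin n) ℝ :=
  Matrix.of fun k l => ∫ ω, projMat A ω i k l ∂(sphereLaw n p)

/-- `T_i = tr(A² E[P_i])`. -/
def Tstat (n p : ℕ) (A : Matrix (Fin n) (Fin n) ℝ) (i : ℕ) : ℝ :=
  Matrix.trace (A * A * meanProj n p A i)

/-- `Q_i = A P_i A / T_i`. -/
def Qmat {n p : ℕ} (A : Matrix (Fin n) (Fin n) ℝ) (ω : Fin p → Fin n → ℝ) (i : ℕ) :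
    Matrix (Fin n) (Fin n) ℝ :=
  (Tstat n p A i)⁻¹ • (A * projMat A ω i * A)

/-- `Z̃_{i+1} = n u_{i+1}ᵀ Q_i u_{i+1} − 1`. -/
def Ztil {n p : ℕ} (A : Matrix (Fin n) (Fin n) ℝ) (ω : Fin p → Fin n → ℝ) (i : ℕ) : ℝ :=
  (n : ℝ) * (uVec ω i ⬝ᵥ (Qmat A ω i).mulVec (uVec ω i)) - 1

/-- The variance `Var(f) = E[(f − E f)²]` of a real random variable `f` under `μ`. -/
def varInt {α : Type*} [MeasurableSpace α] (μ : Measure α) (f : α → ℝ) : ℝ :=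
  ∫ ω, (f ω - ∫ ω', f ω' ∂μ) ^ 2 ∂μ

end

lemma vpd_resample {ι : Type*} [Fintype ι] [DecidableEq ι] {α : Type*} [MeasurableSpace α]
    (μ : Measure α) [IsProbabilityMeasure μ] (j : ι) :
    MeasurePreserving (fun q : (ι → α) × α => Function.update q.1 j q.2)
      ((Measure.pi fun _ : ι => μ).prod μ) (Measure.pi fun _ : ι => μ) := by
  have hm : Measurable (fun q : (ι → α) × α => Function.update q.1 j q.2) := by
    rw [measurable_pi_iff]
    intro a
    by_cases h : a = j
    · subst h; simpa using measurable_snd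
    · simp only [Function.update_of_ne h]
      exact (measurable_pi_apply a).comp measurable_fst
  refine ⟨hm, ?_⟩
  symm
  apply Measure.pi_eq
  intro s hs
  rw [Measure.map_apply hm (MeasurableSet.univ_pi hs)]
  have : (fun q : (ι → α) × α => Function.update q.1 j q.2) ⁻¹' (Set.univ.pi s)
      = (Set.univ.pi (Function.update s j Set.univ)) ×ˢ (s j) := by
    ext ⟨x, t⟩
    simp only [Set.mem_preimage, Set.mem_univ_pi, Set.mem_prod]
    constructor
    · intro h
      refine ⟨fun a => ?_, by simpa using h j⟩
      by_cases ha : a = j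
      · subst ha; simp
      · have := h a
        simpa [Function.update_of_ne ha] using this
    · rintro ⟨h1, h2⟩ a
      by_cases ha : a = j
      · subst ha; simpa using h2
      · have := h1 a
        simpa [Function.update_of_ne ha] using this
  rw [this, Measure.prod_prod, Measure.pi_pi]
  rw [← Finset.mul_prod_erase Finset.univ _ (Finset.mem_univ j),
    ← Finset.mul_prod_erase Finset.univ (fun i => μ (s i)) (Finset.mem_univ j)]
  simp only [Function.update_self, measure_univ, one_mul]
  rw [mul_comm]
  congr 1
  apply Finset.prod_congr rfl
  intro a ha
  rw [Function.update_of_ne (Finset.ne_of_mem_erase ha)]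

lemma vpd_resample_integral {ι : Type*} [Fintype ι] [DecidableEq ι] {α : Type*} [MeasurableSpace α]
    (μ : Measure α) [IsProbabilityMeasure μ] (j : ι) (f : (ι → α) → ℝ)
    (hf : Integrable f (Measure.pi fun _ : ι => μ)) :
    ∫ x, f x ∂(Measure.pi fun _ : ι => μ)
      = ∫ x, ∫ t, f (Function.update x j t) ∂μ ∂(Measure.pi fun _ : ι => μ) := by
  have h := vpd_resample μ j
  have hintg : Integrable (fun q : (ι → α) × α => f (Function.update q.1 j q.2))
      ((Measure.pi fun _ : ι => μ).prod μ) := h.integrable_comp_of_integrable hf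
  rw [← integral_prod _ hintg]
  conv_lhs => rw [← h.map_eq]
  rw [integral_map h.measurable.aemeasurable]
  rw [h.map_eq]; exact hf.aestronglyMeasurable

lemma vpd_int {α : Type*} [MeasurableSpace α] {μ : Measure α} [IsProbabilityMeasure μ]
    {f : α → ℝ} (hf : Measurable f) (K : ℝ) (hb : ∀ x, |f x| ≤ K) : Integrable f μ :=
  Integrable.of_bound hf.aestronglyMeasurable K (Eventually.of_forall hb)

lemma vpd_var_le {α : Type*} [MeasurableSpace α] {μ : Measure α} [IsProbabilityMeasure μ]
    {f : α → ℝ} (hf : Measurable f) (K : ℝ) (hb : ∀ x, |f x| ≤ K) (c : ℝ) :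
    ∫ x, (f x - c) ^ 2 ∂μ = ∫ x, (f x - ∫ y, f y ∂μ) ^ 2 ∂μ + ((∫ y, f y ∂μ) - c) ^ 2 := by
  have hi := vpd_int (μ := μ) hf K hb
  have hi2 : Integrable (fun x => f x ^ 2) μ := by
    apply vpd_int (hf.pow_const 2) (K ^ 2)
    intro x
    rw [abs_pow]; exact pow_le_pow_left₀ (abs_nonneg _) (hb x) 2
  have key : ∀ a : ℝ, ∫ x, (f x - a) ^ 2 ∂μ = ∫ x, f x ^ 2 ∂μ - 2 * a * ∫ x, f x ∂μ + a ^ 2 := by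
    intro a
    have : ∀ x, (f x - a) ^ 2 = (f x ^ 2 - 2 * a * f x) + a ^ 2 := fun x => by ring
    simp_rw [this]
    have hi3 : Integrable (fun x => f x ^ 2 - 2 * a * f x) μ := hi2.sub (hi.const_mul _)
    rw [integral_add hi3 (integrable_const _),
      integral_sub hi2 (hi.const_mul _), integral_const_mul]
    simp
  rw [key, key]; ring

lemma vpd_efron_stein {α : Type*} [MeasurableSpace α] (μ : Measure α) [IsProbabilityMeasure μ]
    (a : α) (K : ℝ) : ∀ (p : ℕ) (f : (Fin p → α) → ℝ), Measurable f → (∀ x, |f x| ≤ K) →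
    ∫ ω, (f ω - ∫ ω', f ω' ∂(Measure.pi fun _ : Fin p => μ)) ^ 2 ∂(Measure.pi fun _ : Fin p => μ)
      ≤ ∑ l : Fin p, ∫ ω, (f ω - f (Function.update ω l a)) ^ 2 ∂(Measure.pi fun _ : Fin p => μ) := by
  intro p
  induction p with
  | zero =>
    intro f hf hb
    have : ∀ ω, f ω = f default := fun ω => by congr 1; exact Subsingleton.elim _ _
    simp [this]
  | succ p ih =>
    intro f hf hb
    set ν := (Measure.pi fun _ : Fin p => μ) with hν
    have mp := (measurePreserving_piFinSuccAbove (fun _ : Fin (p+1) => μ) 0).symm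
    have hK : 0 ≤ K := (abs_nonneg _).trans (hb (Classical.choice (by
      have : Nonempty α := ⟨a⟩
      infer_instance)))
    set g : α × (Fin p → α) → (Fin (p+1) → α) := fun q => Fin.cons q.1 q.2 with hg
    have mp' : MeasurePreserving g (μ.prod ν) (Measure.pi fun _ : Fin (p+1) => μ) := by
      convert mp using 1
      ext q : 1
      simp [hg, MeasurableEquiv.piFinSuccAbove, Fin.insertNthEquiv]
      
    have emb : ∀ F : (Fin (p+1) → α) → ℝ, Measurable F →
        ∫ ω, F ω ∂(Measure.pi fun _ : Fin (p+1) => μ) = ∫ q, F (g q) ∂(μ.prod ν) := by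
      intro F hF
      rw [← mp'.map_eq, integral_map mp'.measurable.aemeasurable hF.aestronglyMeasurable]
    have hup : ∀ l : Fin (p+1), Measurable (fun ω : Fin (p+1) → α => f (Function.update ω l a)) := by
      intro l
      exact hf.comp (measurable_update_left)
    have hupd : ∀ l : Fin (p+1),
        Measurable (fun ω : Fin (p+1) → α => (f ω - f (Function.update ω l a)) ^ 2) := by
      intro l
      exact (hf.sub (hup l)).pow_const 2
    have hfg : Measurable (fun q => f (g q)) := hf.comp mp'.measurable
    have hsq : ∀ u v : ℝ, |u| ≤ K → |v| ≤ K → |(u - v) ^ 2| ≤ (2 * K) ^ 2 := by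
      intro u v hu hv
      rw [abs_pow]
      apply pow_le_pow_left₀ (abs_nonneg _)
      calc |u - v| ≤ |u| + |v| := abs_sub _ _
        _ ≤ 2 * K := by linarith
    set m := ∫ q, f (g q) ∂(μ.prod ν) with hm
    set h : α → ℝ := fun x => ∫ y, f (g (x, y)) ∂ν with hh
    have hhm : Measurable h := (hfg.stronglyMeasurable.integral_prod_right').measurable
    have habs : ∀ {β : Type _} [MeasurableSpace β] (ρ : Measure β) [IsProbabilityMeasure ρ]
        (F : β → ℝ), (∀ x, |F x| ≤ K) → |∫ x, F x ∂ρ| ≤ K := by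
      intro β _ ρ _ F hF
      have := norm_integral_le_of_norm_le_const (μ := ρ) (f := F) (C := K) (Eventually.of_forall hF)
      simpa using this
    have hhb : ∀ x, |h x| ≤ K := fun x => habs ν _ (fun y => hb _)
    have hmb : |m| ≤ K := by
      have := norm_integral_le_of_norm_le_const (μ := μ.prod ν) (f := fun q => f (g q)) (C := K)
        (Eventually.of_forall fun q => hb _)
      simpa using this
    have hmh : m = ∫ x, h x ∂μ := by
      rw [hm, integral_prod _ (vpd_int hfg K fun _ => hb _)]
    rw [emb f hf, emb _ (((hf.sub_const _)).pow_const 2), Fin.sum_univ_succ,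
      emb _ (hupd 0)]
    have hsum : ∑ l : Fin p, ∫ ω, (f ω - f (Function.update ω l.succ a)) ^ 2
          ∂(Measure.pi fun _ : Fin (p+1) => μ)
        = ∑ l : Fin p, ∫ x, ∫ y, (f (g (x, y)) - f (g (x, Function.update y l a))) ^ 2 ∂ν ∂μ := by
      apply Finset.sum_congr rfl
      intro l _
      rw [emb _ (hupd _), integral_prod]
      · simp only [hg, Fin.cons_update]
      · exact vpd_int ((hupd _).comp mp'.measurable) _
          (fun q => hsq _ _ (hb _) (hb _))
    rw [hsum]
    have hfx : ∀ x, Measurable (fun y => f (g (x, y))) := fun x => hfg.comp measurable_prodMk_left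
    have hfy : ∀ y, Measurable (fun x => f (g (x, y))) := fun x => hfg.comp measurable_prodMk_right
    have m1 : Measurable (fun q : α × (Fin p → α) => (f (g q) - h q.1) ^ 2) :=
      (hfg.sub (hhm.comp measurable_fst)).pow_const 2
    have i1 : Integrable (fun q : α × (Fin p → α) => (f (g q) - h q.1) ^ 2) (μ.prod ν) :=
      vpd_int m1 _ (fun q => hsq _ _ (hb _) (hhb _))
    have m0 : Measurable (fun q : α × (Fin p → α) => (f (g q) - f (g (a, q.2))) ^ 2) :=
      (hfg.sub (hfg.comp (measurable_const.prodMk measurable_snd))).pow_const 2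
    have i0 : Integrable (fun q : α × (Fin p → α) => (f (g q) - f (g (a, q.2))) ^ 2) (μ.prod ν) :=
      vpd_int m0 _ (fun q => hsq _ _ (hb _) (hb _))
    have im : Integrable (fun q : α × (Fin p → α) => (f (g q) - m) ^ 2) (μ.prod ν) :=
      vpd_int ((hfg.sub_const _).pow_const 2) _ (fun q => hsq _ _ (hb _) hmb)
    have il : ∀ l : Fin p, Integrable (fun q : α × (Fin p → α) =>
        (f (g q) - f (g (q.1, Function.update q.2 l a))) ^ 2) (μ.prod ν) := by
      intro l
      refine vpd_int ((hfg.sub (hfg.comp (measurable_fst.prodMk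
        ((measurable_update_left).comp measurable_snd)))).pow_const 2) _
        (fun q => hsq _ _ (hb _) (hb _))
    have e1 : ∫ q, (f (g q) - m) ^ 2 ∂(μ.prod ν)
        = ∫ x, ∫ y, (f (g (x, y)) - h x) ^ 2 ∂ν ∂μ + ∫ x, (h x - m) ^ 2 ∂μ := by
      rw [integral_prod _ im, ← integral_add i1.integral_prod_left
        (vpd_int ((hhm.sub_const _).pow_const 2) _ (fun q => hsq _ _ (hhb _) hmb))]
      congr 1
      ext x
      exact vpd_var_le (hfx x) K (fun _ => hb _) m
    have e2 : ∫ x, (h x - m) ^ 2 ∂μ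
        ≤ ∫ q, (f (g q) - f (Function.update (g q) 0 a)) ^ 2 ∂(μ.prod ν) := by
      have : ∀ q, Function.update (g q) 0 a = g (a, q.2) := by
        intro q; simp [hg, Fin.update_cons_zero]
      simp_rw [this]
      have hv := vpd_var_le (μ := μ) hhm K hhb (h a)
      rw [← hmh] at hv
      calc ∫ x, (h x - m) ^ 2 ∂μ ≤ ∫ x, (h x - h a) ^ 2 ∂μ := by
            rw [hv]; linarith [sq_nonneg (m - h a)]
        _ ≤ ∫ x, ∫ y, (f (g (x, y)) - f (g (a, y))) ^ 2 ∂ν ∂μ := by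
            apply integral_mono
              (vpd_int ((hhm.sub_const _).pow_const 2) _ (fun q => hsq _ _ (hhb _) (hhb _)))
              i0.integral_prod_left
            intro x
            have e : h x - h a = ∫ y, (f (g (x, y)) - f (g (a, y))) ∂ν :=
              (integral_sub (vpd_int (hfx x) K fun _ => hb _) (vpd_int (hfx a) K fun _ => hb _)).symm
            have := vpd_var_le (μ := ν) (f := fun y => f (g (x, y)) - f (g (a, y)))
              ((hfx x).sub (hfx a)) (2 * K) (fun y => by
                calc _ ≤ |f (g (x, y))| + |f (g (a, y))| := abs_sub _ _
                  _ ≤ _ := by linarith [hb (g (x, y)), hb (g (a, y))]) 0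
            simp only [sub_zero] at this
            show (h x - h a) ^ 2 ≤ ∫ y, (f (g (x, y)) - f (g (a, y))) ^ 2 ∂ν
            rw [e, this]
            have : 0 ≤ ∫ y, ((f (g (x, y)) - f (g (a, y)))
              - ∫ y, (f (g (x, y)) - f (g (a, y))) ∂ν) ^ 2 ∂ν := integral_nonneg fun _ => sq_nonneg _
            linarith
        _ = _ := (integral_prod _ i0).symm
    have e3 : ∫ x, ∫ y, (f (g (x, y)) - h x) ^ 2 ∂ν ∂μ
        ≤ ∑ l : Fin p, ∫ x, ∫ y, (f (g (x, y)) - f (g (x, Function.update y l a))) ^ 2 ∂ν ∂μ := by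
      rw [← integral_finsetSum _ (fun l _ => (il l).integral_prod_left)]
      apply integral_mono i1.integral_prod_left
        (integrable_finsetSum _ fun l _ => (il l).integral_prod_left)
      intro x
      exact ih (fun y => f (g (x, y))) (hfx x) (fun _ => hb _)
    linarith

lemma vpd_stein1 (F F' : ℝ → ℝ) (hF : ∀ x, HasDerivAt F (F' x) x) (K : ℝ)
    (hb : ∀ x, |F x| ≤ K) (hb' : ∀ x, |F' x| ≤ K) :
    ∫ t, t * F t ∂(gaussianReal 0 1) = ∫ t, F' t ∂(gaussianReal 0 1) := by
  have hFm : Measurable F := (continuous_iff_continuousAt.2 fun x => (hF x).continuousAt).measurable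
  have hF'm : Measurable F' := by
    have : F' = deriv F := by ext x; exact (hF x).deriv.symm
    rw [this]; exact measurable_deriv F
  rw [integral_gaussianReal_eq_integral_smul one_ne_zero,
    integral_gaussianReal_eq_integral_smul one_ne_zero]
  simp only [smul_eq_mul]
  set φ := gaussianPDFReal 0 1 with hφ
  have hder : ∀ x, HasDerivAt φ (-(x * φ x)) x := by
    intro x
    have : φ = fun x => (√(2 * Real.pi * 1))⁻¹ * Real.exp (-(x - 0) ^ 2 / (2 * 1)) := by
      rw [hφ, gaussianPDFReal_def]; simp
    rw [this]
    have h1 : HasDerivAt (fun x : ℝ => -(x - 0) ^ 2 / (2 * 1)) (-x) x := by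
      have := (((hasDerivAt_id x).sub_const 0).pow 2).neg.div_const (2 * 1 : ℝ)
      refine this.congr_deriv ?_
      simp
      ring
    have := (h1.exp).const_mul ((√(2 * Real.pi * 1))⁻¹)
    refine this.congr_deriv ?_
    ring
  have iφ : Integrable φ := integrable_gaussianPDFReal 0 1
  have ixφ : Integrable (fun x => x * φ x) := by
    have h := (integrable_mul_exp_neg_mul_sq (b := 1/2) (by norm_num)).const_mul ((√(2 * Real.pi))⁻¹)
    convert h using 1
    ext x
    simp [hφ, gaussianPDFReal_def]
    ring_nf
  have := integral_mul_deriv_eq_deriv_mul_of_integrable (u := F) (v := φ) (u' := F')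
    (v' := fun x => -(x * φ x)) (fun x _ => hF x) (fun x _ => hder x)
    (ixφ.neg.bdd_mul (c := K) hFm.aestronglyMeasurable (Eventually.of_forall hb))
    (iφ.bdd_mul (c := K) hF'm.aestronglyMeasurable (Eventually.of_forall hb'))
    (iφ.bdd_mul (c := K) hFm.aestronglyMeasurable (Eventually.of_forall hb))
  calc ∫ x, φ x * (x * F x) = - ∫ x, F x * (-(x * φ x)) := by
        rw [← integral_neg]; congr 1; ext x; ring
    _ = ∫ x, F' x * φ x := by rw [this, neg_neg]
    _ = _ := by congr 1; ext x; ring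

instance vpd_gp_prob (n : ℕ) : IsProbabilityMeasure (gaussianPi n) := by
  unfold gaussianPi; infer_instance

lemma vpd_coord_int {n : ℕ} (j : Fin n) : Integrable (fun x : Fin n → ℝ => x j) (gaussianPi n) := by
  have h := measurePreserving_eval (fun _ : Fin n => gaussianReal 0 1) j
  have hi : Integrable (fun t : ℝ => t) (gaussianReal 0 1) :=
    (memLp_id_gaussianReal 1).integrable (by simp)
  exact h.integrable_comp_of_integrable hi

lemma vpd_stein {n : ℕ} (j : Fin n) (F F' : (Fin n → ℝ) → ℝ) (hFm : Measurable F)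
    (hF'm : Measurable F')
    (hF : ∀ x t, HasDerivAt (fun t => F (Function.update x j t)) (F' (Function.update x j t)) t)
    (K : ℝ) (hb : ∀ x, |F x| ≤ K) (hb' : ∀ x, |F' x| ≤ K) :
    Integrable (fun x => x j * F x) (gaussianPi n) ∧
    ∫ x, x j * F x ∂(gaussianPi n) = ∫ x, F' x ∂(gaussianPi n) := by
  have hi : Integrable (fun x => x j * F x) (gaussianPi n) :=
    (vpd_coord_int j).mul_bdd (c := K) hFm.aestronglyMeasurable (Eventually.of_forall hb)
  refine ⟨hi, ?_⟩
  have e1 := vpd_resample_integral (gaussianReal 0 1) j _ hi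
  have e2 := vpd_resample_integral (gaussianReal 0 1) j _ (vpd_int (μ := gaussianPi n) hF'm K hb')
  unfold gaussianPi
  rw [e1, e2]
  congr 1
  ext x
  simp only [Function.update_self]
  exact vpd_stein1 _ _ (hF x) K (fun _ => hb _) (fun _ => hb' _)

lemma vpd_update_eq {n : ℕ} (x : Fin n → ℝ) (j : Fin n) (t : ℝ) :
    Function.update x j t = Function.update x j 0 + t • Pi.single j 1 := by
  ext a
  by_cases h : a = j
  · subst h; simp
  · simp [h]

lemma vpd_cont_quad {n : ℕ} (M : Matrix (Fin n) (Fin n) ℝ) :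
    Continuous (fun x : Fin n → ℝ => x ⬝ᵥ M *ᵥ x) := by
  fun_prop

lemma vpd_neg_step {n : ℕ} (M : Matrix (Fin n) (Fin n) ℝ) (hs : Mᵀ = M) (C : ℝ) (hC : 0 < C)
    (hM : ∀ x, M *ᵥ x ⬝ᵥ M *ᵥ x ≤ C * (x ⬝ᵥ M *ᵥ x)) (ε : ℝ) (hε : 0 < ε) (k : ℕ) :
    (M.trace - 2 * (k + 1) * C) * ∫ x, ((x ⬝ᵥ M *ᵥ x + ε)⁻¹) ^ (k + 1) ∂(gaussianPi n)
      ≤ ∫ x, ((x ⬝ᵥ M *ᵥ x + ε)⁻¹) ^ k ∂(gaussianPi n) := by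
  set D : (Fin n → ℝ) → ℝ := fun x => x ⬝ᵥ M *ᵥ x with hD
  have hD0 : ∀ x, 0 ≤ D x := by
    intro x
    have h1 : 0 ≤ M *ᵥ x ⬝ᵥ M *ᵥ x := Finset.sum_nonneg fun i _ => mul_self_nonneg _
    exact nonneg_of_mul_nonneg_right (h1.trans (hM x)) hC
  have hMj : ∀ x j, (M *ᵥ x) j ^ 2 ≤ C * D x := by
    intro x j
    refine le_trans ?_ (hM x)
    rw [sq]
    exact Finset.single_le_sum (f := fun i => (M *ᵥ x) i * (M *ᵥ x) i)
      (fun i _ => mul_self_nonneg _) (Finset.mem_univ j)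
  set q : (Fin n → ℝ) → ℝ := fun x => (D x + ε)⁻¹ with hq
  have hDε : ∀ x, 0 < D x + ε := fun x => by linarith [hD0 x]
  have hq0 : ∀ x, 0 < q x := fun x => inv_pos.2 (hDε x)
  have hq1 : ∀ x, q x ≤ ε⁻¹ := fun x => inv_anti₀ hε (by linarith [hD0 x])
  have hqD : ∀ x, (D x + ε) * q x = 1 := fun x => mul_inv_cancel₀ (hDε x).ne'
  have hqp : ∀ x m, q x ^ m ≤ ε⁻¹ ^ m := fun x m => pow_le_pow_left₀ (hq0 x).le (hq1 x) m
  have hDm : Measurable D := (vpd_cont_quad M).measurable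
  have hqm : Measurable q := (hDm.add_const ε).inv
  have hMm : ∀ j, Measurable (fun x : Fin n → ℝ => (M *ᵥ x) j) := by
    intro j
    have : Continuous (fun x : Fin n → ℝ => (M *ᵥ x) j) := by fun_prop
    exact this.measurable
  have hiq : ∀ m, Integrable (fun x => q x ^ m) (gaussianPi n) := by
    intro m
    apply vpd_int (hqm.pow_const m) (ε⁻¹ ^ m)
    intro x
    rw [abs_of_nonneg (pow_nonneg (hq0 x).le m)]; exact hqp x m
  set F : Fin n → (Fin n → ℝ) → ℝ := fun j x => (M *ᵥ x) j * q x ^ (k + 1) with hF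
  set F' : Fin n → (Fin n → ℝ) → ℝ := fun j x =>
    M j j * q x ^ (k + 1) - 2 * (k + 1) * ((M *ᵥ x) j ^ 2 * q x ^ (k + 2)) with hF'
  have hk : ∀ x, C * D x * q x ≤ C := by
    intro x
    have : D x * q x ≤ 1 := by
      have := hqD x
      nlinarith [hq0 x]
    nlinarith
  have hMq : ∀ x j m, (M *ᵥ x) j ^ 2 * q x ^ (m + 1) ≤ C * q x ^ m := by
    intro x j m
    calc (M *ᵥ x) j ^ 2 * q x ^ (m + 1) ≤ C * D x * q x ^ (m + 1) :=
          mul_le_mul_of_nonneg_right (hMj x j) (pow_nonneg (hq0 x).le _)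
      _ = (C * D x * q x) * q x ^ m := by ring
      _ ≤ C * q x ^ m := mul_le_mul_of_nonneg_right (hk x) (pow_nonneg (hq0 x).le _)
  have hst : ∀ j, Integrable (fun x => x j * F j x) (gaussianPi n) ∧
      ∫ x, x j * F j x ∂(gaussianPi n) = ∫ x, F' j x ∂(gaussianPi n) := by
    intro j
    set K := (ε⁻¹ ^ (k + 1) + C * ε⁻¹ ^ k) + (|M j j| * ε⁻¹ ^ (k + 1)
      + 2 * (k + 1) * (C * ε⁻¹ ^ (k + 1))) with hK
    have hεp : ∀ m : ℕ, 0 ≤ ε⁻¹ ^ m := fun m => pow_nonneg (inv_nonneg.2 hε.le) m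
    refine vpd_stein j (F j) (F' j) ((hMm j).mul (hqm.pow_const _))
      (((hqm.pow_const _).const_mul _).sub ((((hMm j).pow_const 2).mul (hqm.pow_const _)).const_mul _))
      ?_ K ?_ ?_
    · intro x t
      set y := Function.update x j 0 with hy
      have eM : ∀ t, (M *ᵥ Function.update x j t) j = (M *ᵥ y) j + t * M j j := by
        intro t
        rw [vpd_update_eq, mulVec_add, mulVec_smul]
        simp [hy]
      have eD : ∀ t, D (Function.update x j t) = D y + 2 * t * (M *ᵥ y) j + t ^ 2 * M j j := by
        intro t
        have e : y ⬝ᵥ M *ᵥ (Pi.single j 1) = (M *ᵥ y) j := by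
          rw [dotProduct_mulVec, ← mulVec_transpose, hs]; simp
        simp only [hD]
        rw [vpd_update_eq, mulVec_add, mulVec_smul, ← hy]
        simp only [add_dotProduct, dotProduct_add, smul_dotProduct, dotProduct_smul, e]
        simp
        ring
      have d1 : HasDerivAt (fun t => (M *ᵥ Function.update x j t) j) (M j j) t := by
        simp only [eM]
        have := ((hasDerivAt_id t).mul_const (M j j)).const_add ((M *ᵥ y) j)
        simpa using this
      have d2 : HasDerivAt (fun t => D (Function.update x j t))
          (2 * (M *ᵥ Function.update x j t) j) t := by
        simp only [eM, eD]
        have h1 := (((hasDerivAt_id t).const_mul 2).mul_const ((M *ᵥ y) j)).const_add (D y)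
        have h2 := ((hasDerivAt_id t).pow 2).mul_const (M j j)
        refine (h1.add h2).congr_deriv ?_
        simp
        ring
      have d3 := (d2.add_const ε).inv (hDε _).ne'
      have d4 := d1.mul (d3.pow (k + 1))
      refine d4.congr_deriv ?_
      simp only [hF', hq]
      have := (hDε (Function.update x j t)).ne'
      simp only [Pi.pow_apply, Pi.inv_apply, add_tsub_cancel_right]
      push_cast
      rw [div_eq_mul_inv, ← inv_pow]
      ring
    · intro x
      have h1 : |F j x| ≤ q x ^ (k + 1) + (M *ᵥ x) j ^ 2 * q x ^ (k + 1) := by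
        simp only [hF]
        rw [abs_mul, abs_of_nonneg (pow_nonneg (hq0 x).le _), ← one_add_mul]
        apply mul_le_mul_of_nonneg_right _ (pow_nonneg (hq0 x).le _)
        rw [← sq_abs]
        nlinarith [sq_nonneg (|(M *ᵥ x) j| - 1), abs_nonneg ((M *ᵥ x) j)]
      have h2 := hMq x j k
      have h3 := hqp x k
      have h4 := hqp x (k + 1)
      have h5 : C * q x ^ k ≤ C * ε⁻¹ ^ k := mul_le_mul_of_nonneg_left h3 hC.le
      have h6 : 0 ≤ |M j j| * ε⁻¹ ^ (k + 1) := mul_nonneg (abs_nonneg _) (hεp _)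
      have h7 : 0 ≤ 2 * ((k : ℝ) + 1) * (C * ε⁻¹ ^ (k + 1)) := by
        have := hεp (k + 1)
        positivity
      linarith
    · intro x
      have h1 : |F' j x| ≤ |M j j| * q x ^ (k + 1)
          + 2 * (k + 1) * ((M *ᵥ x) j ^ 2 * q x ^ (k + 2)) := by
        have hq0x := hq0 x
        refine (abs_sub _ _).trans (le_of_eq ?_)
        rw [abs_mul, abs_of_nonneg (pow_nonneg (hq0 x).le (k + 1))]
        congr 1
        apply abs_of_nonneg
        positivity
      have h2 := hMq x j (k + 1)
      have h4 := hqp x (k + 1)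
      have h5 : C * q x ^ (k + 1) ≤ C * ε⁻¹ ^ (k + 1) := mul_le_mul_of_nonneg_left h4 hC.le
      have h6 : |M j j| * q x ^ (k + 1) ≤ |M j j| * ε⁻¹ ^ (k + 1) :=
        mul_le_mul_of_nonneg_left h4 (abs_nonneg _)
      have h7 : 2 * ((k : ℝ) + 1) * ((M *ᵥ x) j ^ 2 * q x ^ (k + 2))
          ≤ 2 * (k + 1) * (C * ε⁻¹ ^ (k + 1)) :=
        mul_le_mul_of_nonneg_left (h2.trans h5) (by positivity)
      have h8 : 0 ≤ C * ε⁻¹ ^ k := mul_nonneg hC.le (hεp k)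
      linarith [hεp (k + 1)]
  have hF'i : ∀ j, Integrable (F' j) (gaussianPi n) := by
    intro j
    have h2 : Integrable (fun x => (M *ᵥ x) j ^ 2 * q x ^ (k + 2)) (gaussianPi n) := by
      apply vpd_int (((hMm j).pow_const 2).mul (hqm.pow_const _)) (C * ε⁻¹ ^ (k + 1))
      intro x
      have hq0x := hq0 x
      show |(M *ᵥ x) j ^ 2 * q x ^ (k + 2)| ≤ _
      rw [abs_of_nonneg (by positivity)]
      exact (hMq x j (k + 1)).trans (mul_le_mul_of_nonneg_left (hqp x (k + 1)) hC.le)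
    exact ((hiq (k + 1)).const_mul _).sub (h2.const_mul _)
  have hsumeq : ∫ x, ∑ j, x j * F j x ∂(gaussianPi n) = ∫ x, ∑ j, F' j x ∂(gaussianPi n) := by
    rw [integral_finsetSum _ (fun j _ => (hst j).1), integral_finsetSum _ (fun j _ => hF'i j)]
    exact Finset.sum_congr rfl fun j _ => (hst j).2
  have hl : ∫ x, ∑ j, x j * F j x ∂(gaussianPi n) ≤ ∫ x, q x ^ k ∂(gaussianPi n) := by
    apply integral_mono (integrable_finsetSum _ fun j _ => (hst j).1) (hiq k)
    intro x
    have : ∑ j, x j * F j x = D x * q x ^ (k + 1) := by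
      simp only [hF, hD, dotProduct, Finset.sum_mul, mul_assoc]
    show ∑ j, x j * F j x ≤ q x ^ k
    rw [this, pow_succ']
    have h1 : D x * q x ≤ 1 := by
      have := hqD x
      nlinarith [hq0 x]
    have h2 := pow_nonneg (hq0 x).le k
    nlinarith
  have hr : (M.trace - 2 * (k + 1) * C) * ∫ x, q x ^ (k + 1) ∂(gaussianPi n)
      ≤ ∫ x, ∑ j, F' j x ∂(gaussianPi n) := by
    rw [← integral_const_mul]
    apply integral_mono ((hiq (k + 1)).const_mul _) (integrable_finsetSum _ fun j _ => hF'i j)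
    intro x
    have e : ∑ j, F' j x = M.trace * q x ^ (k + 1)
        - 2 * (k + 1) * ((M *ᵥ x ⬝ᵥ M *ᵥ x) * q x ^ (k + 2)) := by
      simp only [hF', Finset.sum_sub_distrib, ← Finset.sum_mul, ← Finset.mul_sum, Matrix.trace,
        Matrix.diag, dotProduct, sq]
    show (M.trace - 2 * (k + 1) * C) * q x ^ (k + 1) ≤ ∑ j, F' j x
    rw [e]
    have h1 : (M *ᵥ x ⬝ᵥ M *ᵥ x) * q x ^ (k + 2) ≤ C * q x ^ (k + 1) := by
      calc _ ≤ C * D x * q x ^ (k + 2) :=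
            mul_le_mul_of_nonneg_right (hM x) (pow_nonneg (hq0 x).le _)
        _ = (C * D x * q x) * q x ^ (k + 1) := by ring
        _ ≤ _ := mul_le_mul_of_nonneg_right (hk x) (pow_nonneg (hq0 x).le _)
    have h2 : 2 * ((k : ℝ) + 1) * ((M *ᵥ x ⬝ᵥ M *ᵥ x) * q x ^ (k + 2))
        ≤ 2 * (k + 1) * (C * q x ^ (k + 1)) := mul_le_mul_of_nonneg_left h1 (by positivity)
    linarith
  linarith

lemma vpd_neg_four {n : ℕ} (M : Matrix (Fin n) (Fin n) ℝ) (hs : Mᵀ = M) (C : ℝ) (hC : 0 < C)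
    (hM : ∀ x, M *ᵥ x ⬝ᵥ M *ᵥ x ≤ C * (x ⬝ᵥ M *ᵥ x)) (ε : ℝ) (hε : 0 < ε)
    (s : ℝ) (hs0 : 0 < s) (hst : s ≤ M.trace - 8 * C) :
    ∫ x, ((x ⬝ᵥ M *ᵥ x + ε)⁻¹) ^ 4 ∂(gaussianPi n) ≤ (s ^ 4)⁻¹ := by
  have hD0 : ∀ x, 0 ≤ x ⬝ᵥ M *ᵥ x := by
    intro x
    have h1 : 0 ≤ M *ᵥ x ⬝ᵥ M *ᵥ x := Finset.sum_nonneg fun i _ => mul_self_nonneg _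
    exact nonneg_of_mul_nonneg_right (h1.trans (hM x)) hC
  have step := vpd_neg_step M hs C hC hM ε hε
  set I : ℕ → ℝ := fun k => ∫ x, ((x ⬝ᵥ M *ᵥ x + ε)⁻¹) ^ k ∂(gaussianPi n) with hI
  have hI0 : ∀ k, 0 ≤ I k := fun k => integral_nonneg fun x =>
    pow_nonneg (inv_nonneg.2 (by linarith [hD0 x])) k
  have key : ∀ k, k ≤ 4 → s ^ k * I k ≤ 1 := by
    intro k
    induction k with
    | zero => intro _; simp [hI]
    | succ k ih =>
      intro hk
      have h1 := step k
      have hk' : (k : ℝ) ≤ 3 := by exact_mod_cast (by omega : k ≤ 3)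
      have h2 : s * I (k + 1) ≤ I k := by
        refine le_trans (mul_le_mul_of_nonneg_right ?_ (hI0 (k + 1))) h1
        nlinarith
      calc s ^ (k + 1) * I (k + 1) = s ^ k * (s * I (k + 1)) := by ring
        _ ≤ s ^ k * I k := mul_le_mul_of_nonneg_left h2 (by positivity)
        _ ≤ 1 := ih (by omega)
  have := key 4 le_rfl
  rw [← one_div, le_div_iff₀ (by positivity)]
  linarith

lemma vpd_exp {n : ℕ} (v : Fin n → ℝ) :
    Integrable (fun x : Fin n → ℝ => Real.exp (v ⬝ᵥ x)) (gaussianPi n) ∧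
    ∫ x, Real.exp (v ⬝ᵥ x) ∂(gaussianPi n) = Real.exp (v ⬝ᵥ v / 2) := by
  have e : (fun x : Fin n → ℝ => Real.exp (v ⬝ᵥ x)) = fun x => ∏ j, Real.exp (v j * x j) := by
    ext x; simp [dotProduct, Real.exp_sum]
  rw [e]
  constructor
  · exact Integrable.fintype_prod (f := fun j t => Real.exp (v j * t))
      (fun j => integrable_exp_mul_gaussianReal (v j))
  · unfold gaussianPi
    rw [integral_fintype_prod_eq_prod (fun j t => Real.exp (v j * t))]
    have : ∀ j, ∫ t, Real.exp (v j * t) ∂(gaussianReal 0 1) = Real.exp (v j * v j / 2) := by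
      intro j
      have := congrFun (mgf_id_gaussianReal (μ := 0) (v := 1)) (v j)
      simp only [mgf, id] at this
      rw [this]; simp; ring
    simp only [this]
    rw [← Real.exp_sum, dotProduct, Finset.sum_div]

lemma vpd_mom8 {n : ℕ} (v : Fin n → ℝ) :
    Integrable (fun x : Fin n → ℝ => (v ⬝ᵥ x) ^ 8) (gaussianPi n) ∧
    ∫ x, (v ⬝ᵥ x) ^ 8 ∂(gaussianPi n) ≤ 2 * 40320 * Real.exp (v ⬝ᵥ v / 2) := by
  have h1 := vpd_exp v
  have h2 := vpd_exp (-v)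
  have hp : ∀ y : ℝ, y ^ 8 ≤ 40320 * (Real.exp y + Real.exp (-y)) := by
    intro y
    have h := Real.pow_div_factorial_le_exp |y| (abs_nonneg y) 8
    have hf : ((Nat.factorial 8 : ℕ) : ℝ) = 40320 := by norm_num [Nat.factorial]
    rw [hf, div_le_iff₀ (by norm_num)] at h
    have h3 : |y| ^ 8 = y ^ 8 := by rw [← abs_pow]; exact abs_of_nonneg (by positivity)
    have h4 : Real.exp |y| ≤ Real.exp y + Real.exp (-y) := by
      rcases abs_cases y with ⟨h, _⟩ | ⟨h, _⟩ <;> rw [h] <;>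
        linarith [Real.exp_pos y, Real.exp_pos (-y)]
    linarith
  have hi : Integrable (fun x : Fin n → ℝ =>
      40320 * (Real.exp (v ⬝ᵥ x) + Real.exp (-v ⬝ᵥ x))) (gaussianPi n) :=
    (h1.1.add h2.1).const_mul _
  have hm : Continuous (fun x : Fin n → ℝ => (v ⬝ᵥ x) ^ 8) := by fun_prop
  have hle : ∀ x : Fin n → ℝ, (v ⬝ᵥ x) ^ 8 ≤ 40320 * (Real.exp (v ⬝ᵥ x) + Real.exp (-v ⬝ᵥ x)) := by
    intro x
    rw [neg_dotProduct]; exact hp _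
  have hi8 : Integrable (fun x : Fin n → ℝ => (v ⬝ᵥ x) ^ 8) (gaussianPi n) := by
    refine hi.mono' hm.aestronglyMeasurable (Eventually.of_forall fun x => ?_)
    rw [Real.norm_eq_abs, abs_of_nonneg (by positivity)]
    exact hle x
  refine ⟨hi8, (integral_mono hi8 hi hle).trans (le_of_eq ?_)⟩
  rw [integral_const_mul, integral_add h1.1 h2.1, h1.2, h2.2]
  simp
  ring

lemma vpd_norm_meas (n : ℕ) : Measurable (fun x : Fin n → ℝ => (euclidNorm x)⁻¹ • x) := by
  have h : Measurable (fun x : Fin n → ℝ => euclidNorm x) := by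
    unfold euclidNorm
    have : Continuous (fun x : Fin n → ℝ => √(∑ j, x j ^ 2)) := by fun_prop
    exact this.measurable
  exact h.inv.smul measurable_id

instance vpd_us_prob (n : ℕ) : IsProbabilityMeasure (uniformSphere n) := by
  unfold uniformSphere
  exact Measure.isProbabilityMeasure_map (vpd_norm_meas n).aemeasurable

instance vpd_sl_prob (n p : ℕ) : IsProbabilityMeasure (sphereLaw n p) := by
  unfold sphereLaw; infer_instance

lemma vpd_self_eq {n : ℕ} (x : Fin n → ℝ) : x ⬝ᵥ x = ∑ j, x j ^ 2 := by
  simp [dotProduct, sq]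

lemma vpd_self_nonneg {n : ℕ} (x : Fin n → ℝ) : 0 ≤ x ⬝ᵥ x := by
  rw [vpd_self_eq]; positivity

lemma vpd_cs {n : ℕ} (v x : Fin n → ℝ) : (v ⬝ᵥ x) ^ 2 ≤ (v ⬝ᵥ v) * (x ⬝ᵥ x) := by
  rw [vpd_self_eq, vpd_self_eq]
  exact Finset.sum_mul_sq_le_sq_mul_sq _ _ _

lemma vpd_sphere_gauss {n : ℕ} (M : Matrix (Fin n) (Fin n) ℝ) (v : Fin n → ℝ) (δ : ℝ)
    (x : Fin n → ℝ) :
    (v ⬝ᵥ ((euclidNorm x)⁻¹ • x)) ^ 2 / (δ + ((euclidNorm x)⁻¹ • x) ⬝ᵥ M *ᵥ ((euclidNorm x)⁻¹ • x))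
      = (v ⬝ᵥ x) ^ 2 / (δ * (x ⬝ᵥ x) + x ⬝ᵥ M *ᵥ x) := by
  by_cases hx : x = 0
  · subst hx; simp
  · have hxx : 0 < x ⬝ᵥ x := lt_of_le_of_ne (vpd_self_nonneg x)
      (fun h => hx (dotProduct_self_eq_zero.1 h.symm))
    have hN : euclidNorm x ^ 2 = x ⬝ᵥ x := by
      rw [euclidNorm, vpd_self_eq, Real.sq_sqrt]; positivity
    have hN0 : euclidNorm x ≠ 0 := by
      intro h; rw [h] at hN; simp only [ne_eq, OfNat.ofNat_ne_zero, not_false_eq_true, zero_pow] at hN; linarith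
    simp only [dotProduct_smul, smul_dotProduct, mulVec_smul, smul_eq_mul]
    rw [← hN]
    generalize x ⬝ᵥ M *ᵥ x = d
    have e : δ + (euclidNorm x)⁻¹ * ((euclidNorm x)⁻¹ * d)
      = (δ * euclidNorm x ^ 2 + d) / euclidNorm x ^ 2 := by field_simp
    rw [e, mul_pow, inv_pow, div_div_eq_mul_div]
    congr 1
    field_simp

lemma vpd_sphere {n : ℕ} (hn : 0 < n) (M : Matrix (Fin n) (Fin n) ℝ) (hs : Mᵀ = M) (C : ℝ)
    (hC : 0 < C)
    (hM : ∀ x, M *ᵥ x ⬝ᵥ M *ᵥ x ≤ C * (x ⬝ᵥ M *ᵥ x)) (v : Fin n → ℝ) (hv : v ⬝ᵥ v ≤ C)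
    (δ : ℝ) (hδ : 0 < δ) (s : ℝ) (hs0 : 0 < s) (hst : s ≤ M.trace - 8 * C) :
    ∫ u, ((v ⬝ᵥ u) ^ 2 / (δ + u ⬝ᵥ M *ᵥ u)) ^ 2 ∂(uniformSphere n)
      ≤ 1 / 2 * (2 * 40320 * Real.exp (C / 2) / (n : ℝ) ^ 2 + (n : ℝ) ^ 2 * (s ^ 4)⁻¹) := by
  have hD0 : ∀ x, 0 ≤ x ⬝ᵥ M *ᵥ x := by
    intro x
    exact nonneg_of_mul_nonneg_right ((vpd_self_nonneg _).trans (hM x)) hC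
  have hqm : Measurable (fun u : Fin n → ℝ => u ⬝ᵥ M *ᵥ u) := (vpd_cont_quad M).measurable
  have hvm : Measurable (fun u : Fin n → ℝ => v ⬝ᵥ u) := by
    have : Continuous (fun u : Fin n → ℝ => v ⬝ᵥ u) := by fun_prop
    exact this.measurable
  have hxm : Measurable (fun u : Fin n → ℝ => u ⬝ᵥ u) := by
    have : Continuous (fun u : Fin n → ℝ => u ⬝ᵥ u) := by fun_prop
    exact this.measurable
  have hmeas : Measurable (fun u : Fin n → ℝ => ((v ⬝ᵥ u) ^ 2 / (δ + u ⬝ᵥ M *ᵥ u)) ^ 2) :=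
    ((hvm.pow_const 2).div (hqm.const_add δ)).pow_const 2
  unfold uniformSphere
  rw [integral_map (vpd_norm_meas n).aemeasurable hmeas.aestronglyMeasurable]
  simp only [vpd_sphere_gauss]
  set ε : ℕ → ℝ := fun k => 1 / ((k : ℝ) + 1) with hε
  have hε0 : ∀ k, 0 < ε k := fun k => by simp only [hε]; positivity
  have hεt : Tendsto ε atTop (𝓝 0) := tendsto_one_div_add_atTop_nhds_zero_nat
  have hlim : Tendsto (fun k => ∫ x, ((v ⬝ᵥ x) ^ 2 / (δ * (x ⬝ᵥ x) + x ⬝ᵥ M *ᵥ x + ε k)) ^ 2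
      ∂(gaussianPi n)) atTop
      (𝓝 (∫ x, ((v ⬝ᵥ x) ^ 2 / (δ * (x ⬝ᵥ x) + x ⬝ᵥ M *ᵥ x)) ^ 2 ∂(gaussianPi n))) := by
    apply tendsto_integral_of_dominated_convergence (fun _ => (v ⬝ᵥ v / δ) ^ 2)
    · intro k
      exact (((hvm.pow_const 2).div (((hxm.const_mul δ).add hqm).add_const _)).pow_const
        2).aestronglyMeasurable
    · exact integrable_const _
    · intro k
      refine Eventually.of_forall fun x => ?_
      have h1 := vpd_self_nonneg x
      have h2 := hD0 x
      have h3 := hε0 k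
      have h4 := vpd_cs v x
      have h5 := vpd_self_nonneg v
      have hpos : 0 < δ * (x ⬝ᵥ x) + x ⬝ᵥ M *ᵥ x + ε k := by positivity
      rw [Real.norm_eq_abs, abs_pow, abs_of_nonneg (by positivity)]
      apply pow_le_pow_left₀ (by positivity)
      rw [div_le_div_iff₀ hpos hδ]
      nlinarith [mul_nonneg h5 h2, mul_nonneg h5 h3.le]
    · refine Eventually.of_forall fun x => ?_
      by_cases hx : x = 0
      · subst hx; simp
      · have hxx : 0 < x ⬝ᵥ x := lt_of_le_of_ne (vpd_self_nonneg x)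
          (fun h => hx (dotProduct_self_eq_zero.1 h.symm))
        have h2 := hD0 x
        have hpos : 0 < δ * (x ⬝ᵥ x) + x ⬝ᵥ M *ᵥ x := by positivity
        have : Tendsto (fun k => δ * (x ⬝ᵥ x) + x ⬝ᵥ M *ᵥ x + ε k) atTop
            (𝓝 (δ * (x ⬝ᵥ x) + x ⬝ᵥ M *ᵥ x)) := by
          simpa using hεt.const_add (δ * (x ⬝ᵥ x) + x ⬝ᵥ M *ᵥ x)
        exact (tendsto_const_nhds.div this hpos.ne').pow 2
  refine le_of_tendsto' hlim fun k => ?_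
  have h8 := vpd_mom8 v
  have h4 := vpd_neg_four M hs C hC hM (ε k) (hε0 k) s hs0 hst
  have hnpos : (0 : ℝ) < n := by exact_mod_cast hn
  have hq4 : Integrable (fun x => ((x ⬝ᵥ M *ᵥ x + ε k)⁻¹) ^ 4) (gaussianPi n) := by
    apply vpd_int ((hqm.add_const _).inv.pow_const 4) ((ε k)⁻¹ ^ 4)
    intro x
    have h2 := hD0 x
    have h3 := hε0 k
    rw [abs_of_nonneg (by positivity)]
    exact pow_le_pow_left₀ (by positivity) (inv_anti₀ h3 (by linarith)) 4
  have hi : Integrable (fun x => 1 / 2 * ((v ⬝ᵥ x) ^ 8 / (n : ℝ) ^ 2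
      + (n : ℝ) ^ 2 * ((x ⬝ᵥ M *ᵥ x + ε k)⁻¹) ^ 4)) (gaussianPi n) :=
    ((h8.1.div_const _).add (hq4.const_mul _)).const_mul _
  have hintg : ∫ x, 1 / 2 * ((v ⬝ᵥ x) ^ 8 / (n : ℝ) ^ 2
      + (n : ℝ) ^ 2 * ((x ⬝ᵥ M *ᵥ x + ε k)⁻¹) ^ 4) ∂(gaussianPi n)
      ≤ 1 / 2 * (2 * 40320 * Real.exp (C / 2) / (n : ℝ) ^ 2 + (n : ℝ) ^ 2 * (s ^ 4)⁻¹) := by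
    rw [integral_const_mul, integral_add (h8.1.div_const _) (hq4.const_mul _), integral_div,
      integral_const_mul]
    have : Real.exp (v ⬝ᵥ v / 2) ≤ Real.exp (C / 2) := Real.exp_le_exp.2 (by linarith)
    gcongr
    exact h8.2.trans (by linarith)
  refine le_trans ?_ hintg
  apply integral_mono_of_nonneg (Eventually.of_forall fun x => sq_nonneg _) hi
  refine Eventually.of_forall fun x => ?_
  have h1 := vpd_self_nonneg x
  have h2 := hD0 x
  have h3 := hε0 k
  have hpos : 0 < x ⬝ᵥ M *ᵥ x + ε k := by positivity
  show ((v ⬝ᵥ x) ^ 2 / (δ * (x ⬝ᵥ x) + x ⬝ᵥ M *ᵥ x + ε k)) ^ 2 ≤ 1 / 2 * ((v ⬝ᵥ x) ^ 8 / (n : ℝ) ^ 2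
      + (n : ℝ) ^ 2 * ((x ⬝ᵥ M *ᵥ x + ε k)⁻¹) ^ 4)
  calc ((v ⬝ᵥ x) ^ 2 / (δ * (x ⬝ᵥ x) + x ⬝ᵥ M *ᵥ x + ε k)) ^ 2
      ≤ ((v ⬝ᵥ x) ^ 2 / (x ⬝ᵥ M *ᵥ x + ε k)) ^ 2 := by
        apply pow_le_pow_left₀ (by positivity)
        apply div_le_div_of_nonneg_left (by positivity) hpos
        nlinarith
    _ ≤ _ := by
        rw [div_eq_mul_inv]
        set a := (v ⬝ᵥ x) ^ 2
        set b := (x ⬝ᵥ M *ᵥ x + ε k)⁻¹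
        have e : (v ⬝ᵥ x) ^ 8 = a ^ 4 := by simp only [a]; ring
        rw [e]
        have : (a * b) ^ 2 = (a ^ 2 / n) * (n * b ^ 2) := by field_simp
        rw [this]
        have e2 : a ^ 4 / (n : ℝ) ^ 2 = (a ^ 2 / n) ^ 2 := by field_simp
        have e3 : (n : ℝ) ^ 2 * b ^ 4 = (n * b ^ 2) ^ 2 := by ring
        rw [e2, e3]
        nlinarith [sq_nonneg (a ^ 2 / (n : ℝ) - n * b ^ 2)]

lemma vpd_hyper_gauss {n : ℕ} (w : Fin n → ℝ) (hw : w ≠ 0) :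
    ∀ᵐ x ∂(gaussianPi n), w ⬝ᵥ x ≠ 0 := by
  obtain ⟨j, hj⟩ := Function.ne_iff.1 hw
  have hj : w j ≠ 0 := hj
  have hvm : Measurable (fun u : Fin n → ℝ => w ⬝ᵥ u) := by
    have : Continuous (fun u : Fin n → ℝ => w ⬝ᵥ u) := by fun_prop
    exact this.measurable
  have hms : MeasurableSet {x : Fin n → ℝ | w ⬝ᵥ x ≠ 0} :=
    (hvm (measurableSet_singleton 0)).compl
  have mp := vpd_resample (ι := Fin n) (gaussianReal 0 1) j
  unfold gaussianPi
  rw [← mp.map_eq, ae_map_iff mp.measurable.aemeasurable hms]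
  have : MeasurableSet {q : (Fin n → ℝ) × ℝ | w ⬝ᵥ Function.update q.1 j q.2 ≠ 0} :=
    mp.measurable hms
  rw [Measure.ae_prod_iff_ae_ae this]
  refine Eventually.of_forall fun x => ?_
  have := nullSingletonClass_gaussianReal (μ := 0) (v := 1) one_ne_zero
  have hne : ∀ᵐ t ∂(gaussianReal 0 1), t ≠ -(w ⬝ᵥ Function.update x j 0) / w j := by
    rw [ae_iff]; simp
  filter_upwards [hne] with t ht h
  apply ht
  rw [vpd_update_eq, dotProduct_add, dotProduct_smul] at h
  simp at h
  field_simp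
  linarith

lemma vpd_hyper {n : ℕ} (w : Fin n → ℝ) (hw : w ≠ 0) :
    ∀ᵐ x ∂(uniformSphere n), w ⬝ᵥ x ≠ 0 := by
  have hvm : Measurable (fun u : Fin n → ℝ => w ⬝ᵥ u) := by
    have : Continuous (fun u : Fin n → ℝ => w ⬝ᵥ u) := by fun_prop
    exact this.measurable
  have hms : MeasurableSet {x : Fin n → ℝ | w ⬝ᵥ x ≠ 0} :=
    (hvm (measurableSet_singleton 0)).compl
  unfold uniformSphere
  rw [ae_map_iff (vpd_norm_meas n).aemeasurable hms]
  filter_upwards [vpd_hyper_gauss w hw] with x hx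
  rw [dotProduct_smul, smul_eq_mul]
  refine mul_ne_zero (inv_ne_zero ?_) hx
  intro h
  rw [euclidNorm, Real.sqrt_eq_zero (by positivity), ← vpd_self_eq, dotProduct_self_eq_zero] at h
  rw [h] at hx; simp at hx

/-- Regularized Gram matrix. -/
noncomputable def vpdS {m n : Type*} [Fintype m] [Fintype n] [DecidableEq n] (B : Matrix m n ℝ) (δ : ℝ) :
    Matrix n n ℝ := δ • 1 + Bᵀ * B

/-- Regularized projection. -/
noncomputable def vpdR {m n : Type*} [Fintype m] [Fintype n] [DecidableEq n] (B : Matrix m n ℝ) (δ : ℝ) :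
    Matrix n n ℝ := δ • (vpdS B δ)⁻¹

section
variable {m n : Type*} [Fintype m] [Fintype n] [DecidableEq n] [DecidableEq m]

lemma vpd_nonneg' (x : n → ℝ) : 0 ≤ x ⬝ᵥ x := Finset.sum_nonneg fun _ _ => mul_self_nonneg _

lemma vpdS_quad (B : Matrix m n ℝ) (δ : ℝ) (x : n → ℝ) :
    x ⬝ᵥ vpdS B δ *ᵥ x = δ * (x ⬝ᵥ x) + (B *ᵥ x) ⬝ᵥ (B *ᵥ x) := by
  have : x ⬝ᵥ (Bᵀ * B) *ᵥ x = (B *ᵥ x) ⬝ᵥ (B *ᵥ x) := by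
    rw [← mulVec_mulVec, dotProduct_mulVec, vecMul_transpose]
  rw [vpdS, add_mulVec, dotProduct_add, this, smul_mulVec, one_mulVec, dotProduct_smul, smul_eq_mul]

lemma vpdS_unit (B : Matrix m n ℝ) {δ : ℝ} (hδ : 0 < δ) : IsUnit (vpdS B δ).det := by
  rw [isUnit_iff_ne_zero]
  intro h
  obtain ⟨v, hv, hv0⟩ := exists_mulVec_eq_zero_iff.2 h
  have := vpdS_quad B δ v
  rw [hv0, dotProduct_zero] at this
  have h1 := vpd_nonneg' v
  have h2 := vpd_nonneg' (B *ᵥ v)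
  apply hv
  apply dotProduct_self_eq_zero.1
  nlinarith

lemma vpdS_symm (B : Matrix m n ℝ) (δ : ℝ) : (vpdS B δ)ᵀ = vpdS B δ := by
  simp [vpdS, transpose_mul]

lemma vpdR_symm (B : Matrix m n ℝ) (δ : ℝ) : (vpdR B δ)ᵀ = vpdR B δ := by
  rw [vpdR, transpose_smul, transpose_nonsing_inv, vpdS_symm]

lemma vpdS_mul_R (B : Matrix m n ℝ) {δ : ℝ} (hδ : 0 < δ) : vpdS B δ * vpdR B δ = δ • 1 := by
  rw [vpdR, mul_smul_comm, mul_nonsing_inv _ (vpdS_unit B hδ)]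

lemma vpdR_unique (B : Matrix m n ℝ) {δ : ℝ} (hδ : 0 < δ) (X : Matrix n n ℝ)
    (h : vpdS B δ * X = δ • 1) : X = vpdR B δ := by
  have : (vpdS B δ)⁻¹ * (vpdS B δ * X) = (vpdS B δ)⁻¹ * (δ • 1) := by rw [h]
  rw [nonsing_inv_mul_cancel_left _ _ (vpdS_unit B hδ)] at this
  rw [this, vpdR]; simp

lemma vpdR_contr (B : Matrix m n ℝ) {δ : ℝ} (hδ : 0 < δ) (x : n → ℝ) :
    (vpdR B δ *ᵥ x) ⬝ᵥ (vpdR B δ *ᵥ x) ≤ x ⬝ᵥ vpdR B δ *ᵥ x := by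
  set y := vpdR B δ *ᵥ x with hy
  have h1 : vpdS B δ *ᵥ y = δ • x := by
    rw [hy, mulVec_mulVec, vpdS_mul_R B hδ, smul_mulVec, one_mulVec]
  have h2 := vpdS_quad B δ y
  rw [h1, dotProduct_smul, smul_eq_mul] at h2
  have h3 := vpd_nonneg' (B *ᵥ y)
  have h4 : δ * (y ⬝ᵥ y) ≤ δ * (y ⬝ᵥ x) := by linarith
  rw [dotProduct_comm x y]
  exact le_of_mul_le_mul_left h4 hδ

lemma vpdR_diag (B : Matrix m n ℝ) {δ : ℝ} (hδ : 0 < δ) (k : n) :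
    0 ≤ vpdR B δ k k ∧ vpdR B δ k k ≤ 1 ∧
      (vpdR B δ *ᵥ Pi.single k 1) ⬝ᵥ (vpdR B δ *ᵥ Pi.single k 1) ≤ 1 := by
  have h := vpdR_contr B hδ (Pi.single k 1)
  have e1 : (Pi.single k 1 : n → ℝ) ⬝ᵥ vpdR B δ *ᵥ (Pi.single k 1) = vpdR B δ k k := by simp
  rw [e1] at h
  have h0 := vpd_nonneg' (vpdR B δ *ᵥ Pi.single k 1)
  have h2 : vpdR B δ k k ^ 2
      ≤ (vpdR B δ *ᵥ Pi.single k 1) ⬝ᵥ (vpdR B δ *ᵥ Pi.single k 1) := by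
    have := Finset.single_le_sum (f := fun i => (vpdR B δ *ᵥ Pi.single k 1) i *
      (vpdR B δ *ᵥ Pi.single k 1) i) (fun i _ => mul_self_nonneg _) (Finset.mem_univ k)
    refine le_trans (le_of_eq ?_) this
    simp [sq]
  refine ⟨by linarith, by nlinarith, by nlinarith⟩

lemma vpdR_woodbury (B : Matrix m n ℝ) {δ : ℝ} (hδ : 0 < δ) :
    vpdR B δ = 1 - Bᵀ * (vpdS Bᵀ δ)⁻¹ * B := by
  symm
  apply vpdR_unique B hδ
  have e : vpdS B δ * Bᵀ = Bᵀ * vpdS Bᵀ δ := by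
    simp only [vpdS, transpose_transpose, Matrix.add_mul, Matrix.mul_add]
    simp [Matrix.mul_assoc]
  rw [Matrix.mul_sub, Matrix.mul_one, ← Matrix.mul_assoc, ← Matrix.mul_assoc, e,
    Matrix.mul_assoc Bᵀ, mul_nonsing_inv _ (vpdS_unit Bᵀ hδ), Matrix.mul_one]
  simp [vpdS]

lemma vpdR_trace (B : Matrix m n ℝ) {δ : ℝ} (hδ : 0 < δ) :
    (Fintype.card n : ℝ) - Fintype.card m ≤ (vpdR B δ).trace := by
  have e : (vpdS Bᵀ δ)⁻¹ * (B * Bᵀ) = 1 - vpdR Bᵀ δ := by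
    have h : B * Bᵀ = vpdS Bᵀ δ - δ • 1 := by simp [vpdS]
    rw [h, Matrix.mul_sub, nonsing_inv_mul _ (vpdS_unit Bᵀ hδ), vpdR]
    simp
  rw [vpdR_woodbury B hδ, trace_sub, trace_one, Matrix.mul_assoc, trace_mul_comm, Matrix.mul_assoc, e,
    trace_sub, trace_one]
  have : 0 ≤ (vpdR Bᵀ δ).trace := Finset.sum_nonneg fun i _ => (vpdR_diag Bᵀ hδ i).1
  linarith

lemma vpdR_rank_one {m' : Type*} [Fintype m'] (B : Matrix m n ℝ) (B' : Matrix m' n ℝ) {δ : ℝ}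
    (hδ : 0 < δ) (b : n → ℝ)
    (h : B'ᵀ * B' = Bᵀ * B + vecMulVec b b) (k : n) :
    vpdR B' δ k k = vpdR B δ k k
      - (vpdR B δ *ᵥ b) k ^ 2 / (δ + b ⬝ᵥ vpdR B δ *ᵥ b) := by
  classical
  set R := vpdR B δ with hR
  have hpos : 0 < δ + b ⬝ᵥ R *ᵥ b := by
    have h1 := vpdR_contr B hδ b
    have h2 := vpd_nonneg' (vpdR B δ *ᵥ b)
    linarith
  have hSR : vpdS B δ * R = δ • 1 := vpdS_mul_R B hδ
  have hS : vpdS B' δ = vpdS B δ + vecMulVec b b := by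
    rw [vpdS, vpdS, h, add_assoc]
  have key : R - (δ + b ⬝ᵥ R *ᵥ b)⁻¹ • vecMulVec (R *ᵥ b) (R *ᵥ b) = vpdR B' δ := by
    apply vpdR_unique B' hδ
    have hbR : b ᵥ* R = R *ᵥ b := by rw [← mulVec_transpose, vpdR_symm]
    rw [hS, Matrix.add_mul, Matrix.mul_sub, Matrix.mul_sub, hSR, mul_smul_comm, mul_smul_comm,
      mul_vecMulVec, mulVec_mulVec, hSR, vecMulVec_mul, hbR, vecMulVec_mul_vecMulVec, smul_mulVec,
      one_mulVec, vecMulVec_smul, smul_vecMulVec]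
    generalize hd : b ⬝ᵥ R *ᵥ b = d at hpos
    ext i j
    simp only [Matrix.add_apply, Matrix.sub_apply, Matrix.smul_apply, smul_eq_mul, vecMulVec_apply]
    field_simp
    ring
  rw [← key]
  simp only [Matrix.sub_apply, Matrix.smul_apply, smul_eq_mul, vecMulVec_apply]
  ring

end

lemma vpd_uVec_cont {n p : ℕ} (i : ℕ) : Continuous (fun ω : Fin p → Fin n → ℝ => uVec ω i) := by
  unfold uVec
  split_ifs <;> fun_prop

lemma vpd_row_cont {n p : ℕ} (A : Matrix (Fin n) (Fin n) ℝ) (i : ℕ) :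
    Continuous (fun ω : Fin p → Fin n → ℝ => rowMat A ω i) := by
  refine continuous_matrix fun k j => ?_
  simp only [rowMat, Matrix.of_apply]
  have := vpd_uVec_cont (n := n) (p := p) (k : ℕ)
  fun_prop

lemma vpd_R_meas {n p : ℕ} (A : Matrix (Fin n) (Fin n) ℝ) (i : ℕ) (δ : ℝ) (k l : Fin n) :
    Measurable (fun ω : Fin p → Fin n → ℝ => vpdR (rowMat A ω i) δ k l) := by
  have h := vpd_row_cont (p := p) A i
  have hS : Continuous (fun ω : Fin p → Fin n → ℝ => vpdS (rowMat A ω i) δ) := by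
    unfold vpdS
    exact continuous_const.add (h.matrix_transpose.matrix_mul h)
  have hd : Continuous (fun ω : Fin p → Fin n → ℝ => (vpdS (rowMat A ω i) δ).det) := hS.matrix_det
  have ha : Continuous (fun ω : Fin p → Fin n → ℝ => (vpdS (rowMat A ω i) δ).adjugate k l) :=
    (hS.matrix_adjugate).matrix_elem k l
  have : (fun ω : Fin p → Fin n → ℝ => vpdR (rowMat A ω i) δ k l) = fun ω =>
      δ * (((vpdS (rowMat A ω i) δ).det)⁻¹ * (vpdS (rowMat A ω i) δ).adjugate k l) := by
    ext ω
    simp [vpdR, Matrix.inv_def]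
  rw [this]
  exact (hd.measurable.inv.mul ha.measurable).const_mul δ

lemma vpd_R_lim {n p : ℕ} (A : Matrix (Fin n) (Fin n) ℝ) (i : ℕ) (k : Fin n)
    (ω : Fin p → Fin n → ℝ) (h : (rowMat A ω i * (rowMat A ω i)ᵀ).det ≠ 0)
    (δ : ℕ → ℝ) (hδ : ∀ r, 0 < δ r) (hδ0 : Tendsto δ atTop (𝓝 0)) :
    Tendsto (fun r => vpdR (rowMat A ω i) (δ r) k k) atTop (𝓝 (projMat A ω i k k)) := by
  set B := rowMat A ω i with hB
  have hS : Continuous (fun t : ℝ => vpdS Bᵀ t) := by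
    unfold vpdS; fun_prop
  have hS0 : vpdS Bᵀ 0 = B * Bᵀ := by simp [vpdS]
  have hinv : ContinuousAt (fun t : ℝ => (vpdS Bᵀ t)⁻¹) 0 := by
    simp only [Matrix.inv_def, Ring.inverse_eq_inv']
    refine ContinuousAt.smul (ContinuousAt.inv₀ hS.matrix_det.continuousAt ?_)
      hS.matrix_adjugate.continuousAt
    rw [hS0]; exact h
  have hT : Tendsto (fun r => (vpdS Bᵀ (δ r))⁻¹) atTop (𝓝 ((B * Bᵀ)⁻¹)) := by
    have := hinv.tendsto.comp hδ0
    rwa [hS0] at this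
  have hc : Continuous (fun X : Matrix (Fin i) (Fin i) ℝ => ((1 : Matrix (Fin n) (Fin n) ℝ) - Bᵀ * X * B) k k) := by
    apply Continuous.matrix_elem
    fun_prop
  have := (hc.tendsto _).comp hT
  have e : ∀ r, vpdR B (δ r) k k = ((1 : Matrix (Fin n) (Fin n) ℝ) - Bᵀ * (vpdS Bᵀ (δ r))⁻¹ * B) k k := fun r => by
    rw [vpdR_woodbury B (hδ r)]
  simp only [e]
  exact this

lemma vpd_row_update_ge {n p : ℕ} (A : Matrix (Fin n) (Fin n) ℝ) (i : ℕ) (l : Fin p)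
    (hl : i ≤ l) (ω : Fin p → Fin n → ℝ) (t : Fin n → ℝ) :
    rowMat A (Function.update ω l t) i = rowMat A ω i := by
  ext k j
  have : uVec (Function.update ω l t) (k : ℕ) = uVec ω (k : ℕ) := by
    unfold uVec
    split_ifs with h
    · rw [Function.update_of_ne]
      intro e
      have := congrArg Fin.val e
      simp at this
      omega
    · rfl
  simp [rowMat, this]

lemma vpd_row_update_lt {n p : ℕ} (A : Matrix (Fin n) (Fin n) ℝ) (i : ℕ) (l : Fin p)
    (hl : (l : ℕ) < i) (ω : Fin p → Fin n → ℝ) (t : Fin n → ℝ) :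
    (rowMat A (Function.update ω l t) i)ᵀ * rowMat A (Function.update ω l t) i
      = (rowMat A (Function.update ω l 0) i)ᵀ * rowMat A (Function.update ω l 0) i
        + vecMulVec (A *ᵥ t) (A *ᵥ t) := by
  ext a c
  simp only [Matrix.add_apply, Matrix.mul_apply, transpose_apply, vecMulVec_apply]
  set l' : Fin i := ⟨l, hl⟩
  have h1 : ∀ s, uVec (Function.update ω l s) (l' : ℕ) = s := by
    intro s
    unfold uVec
    rw [dif_pos l.2]
    simp [l']
  have h2 : ∀ k : Fin i, k ≠ l' → ∀ s, uVec (Function.update ω l s) (k : ℕ) = uVec ω k := by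
    intro k hk s
    unfold uVec
    split_ifs with h
    · rw [Function.update_of_ne]
      intro e
      apply hk
      ext
      have := congrArg Fin.val e
      simpa [l'] using this
    · rfl
  rw [← Finset.add_sum_erase _ _ (Finset.mem_univ l'), ← Finset.add_sum_erase (a := l') Finset.univ
    (fun x => rowMat A (Function.update ω l 0) i x a * rowMat A (Function.update ω l 0) i x c)
    (Finset.mem_univ l')]
  have h3 : ∑ x ∈ Finset.univ.erase l', rowMat A (Function.update ω l t) i x a
        * rowMat A (Function.update ω l t) i x c
      = ∑ x ∈ Finset.univ.erase l', rowMat A (Function.update ω l 0) i x a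
        * rowMat A (Function.update ω l 0) i x c := by
    apply Finset.sum_congr rfl
    intro x hx
    have hx' := Finset.ne_of_mem_erase hx
    simp only [rowMat, Matrix.of_apply, h2 x hx']
  rw [h3]
  simp only [rowMat, Matrix.of_apply, h1]
  simp
  ring

lemma vpd_gram_det {m n : ℕ} (B : Matrix (Fin m) (Fin n) ℝ) :
    (B * Bᵀ).det ≠ 0 ↔ ∀ c : Fin m → ℝ, c ᵥ* B = 0 → c = 0 := by
  rw [Ne, ← Matrix.exists_mulVec_eq_zero_iff]
  push Not
  constructor
  · intro h c hc
    by_contra hne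
    apply h c hne
    rw [← mulVec_mulVec, mulVec_transpose, hc, mulVec_zero]
  · intro h c hne hc
    apply hne
    apply h
    have h1 : (c ᵥ* B) ⬝ᵥ (c ᵥ* B) = 0 := by
      have : c ⬝ᵥ (B * Bᵀ) *ᵥ c = 0 := by rw [hc, dotProduct_zero]
      rwa [← mulVec_mulVec, mulVec_transpose, dotProduct_mulVec] at this
    exact dotProduct_self_eq_zero.mp h1

lemma vpd_uVec_update {n p : ℕ} (l : Fin p) (ω : Fin p → Fin n → ℝ) (t : Fin n → ℝ) :
    uVec (Function.update ω l t) (l : ℕ) = t := by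
  unfold uVec
  rw [dif_pos l.2]
  simp

lemma vpd_row_succ {n p : ℕ} (A : Matrix (Fin n) (Fin n) ℝ) (ω : Fin p → Fin n → ℝ) (m : ℕ)
    (c : Fin (m + 1) → ℝ) :
    c ᵥ* rowMat A ω (m + 1) = (fun k : Fin m => c k.castSucc) ᵥ* rowMat A ω m
      + c (Fin.last m) • A *ᵥ uVec ω m := by
  ext j
  simp [Matrix.vecMul, dotProduct, Fin.sum_univ_castSucc, rowMat]

lemma vpd_nonsing {n p : ℕ} (hpn : p ≤ n) (A : Matrix (Fin n) (Fin n) ℝ)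
    (hA : A.det ≠ 0) (m : ℕ) (hm : m ≤ p) :
    ∀ᵐ ω ∂(sphereLaw n p), (rowMat A ω m * (rowMat A ω m)ᵀ).det ≠ 0 := by
  induction m with
  | zero => simp
  | succ m ih =>
    have ih := ih (by omega)
    let l : Fin p := ⟨m, by omega⟩
    have hmp := vpd_resample (uniformSphere n) l
    have hcont : Continuous (fun ω : Fin p → Fin n → ℝ =>
        (rowMat A ω (m+1) * (rowMat A ω (m+1))ᵀ).det) := by
      have := vpd_row_cont (p := p) A (m+1)
      exact (this.matrix_mul this.matrix_transpose).matrix_det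
    have hms : MeasurableSet {ω : Fin p → Fin n → ℝ |
        (rowMat A ω (m+1) * (rowMat A ω (m+1))ᵀ).det ≠ 0} :=
      (hcont.measurable (measurableSet_singleton 0)).compl
    unfold sphereLaw at ih ⊢
    rw [← hmp.map_eq, ae_map_iff hmp.measurable.aemeasurable hms]
    refine (Measure.ae_prod_iff_ae_ae (hmp.measurable hms)).mpr ?_
    filter_upwards [ih] with x hx
    obtain ⟨w, hw, hBw⟩ : ∃ w : Fin n → ℝ, w ≠ 0 ∧ rowMat A x m *ᵥ w = 0 := by
      have h := LinearMap.ker_ne_bot_of_finrank_lt (f := (rowMat A x m).mulVecLin)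
        (by simp; omega)
      obtain ⟨w, hw1, hw2⟩ := (Submodule.ne_bot_iff _).mp h
      exact ⟨w, hw2, by simpa using hw1⟩
    have hw' : w ᵥ* A ≠ 0 := by
      intro h0
      apply hw
      by_contra
      exact hA (Matrix.exists_vecMul_eq_zero_iff.mp ⟨w, hw, h0⟩)
    filter_upwards [vpd_hyper (w ᵥ* A) hw'] with t ht
    rw [vpd_gram_det] at hx ⊢
    intro c hc
    rw [vpd_row_succ, vpd_row_update_ge A m l (le_refl m)] at hc
    have hu : uVec (Function.update x l t) m = t := vpd_uVec_update l x t
    rw [hu] at hc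
    have h1 := congrArg (fun z => z ⬝ᵥ w) hc
    simp only [add_dotProduct, zero_dotProduct, smul_dotProduct] at h1
    rw [← dotProduct_mulVec, hBw, dotProduct_zero, zero_add, dotProduct_comm (A *ᵥ t) w,
      dotProduct_mulVec, smul_eq_mul] at h1
    have h2 : c (Fin.last m) = 0 := (mul_eq_zero.mp h1).resolve_right ht
    rw [h2, zero_smul, add_zero] at hc
    have h3 := hx _ hc
    ext k
    refine Fin.lastCases h2 (fun k => ?_) k
    exact congrFun h3 k

lemma vpd_term {n m : ℕ} (hn : 0 < n) (d : Fin n → ℝ) (C : ℝ) (hC : 1 ≤ C)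
    (hd : ∀ k, C⁻¹ ≤ d k ^ 2 ∧ d k ^ 2 ≤ C) (B : Matrix (Fin m) (Fin n) ℝ) (δ : ℝ) (hδ : 0 < δ)
    (k : Fin n) (s : ℝ) (hs0 : 0 < s) (hs : s ≤ C⁻¹ * ((n : ℝ) - m) - 8 * C) :
    ∫ u, ((vpdR B δ *ᵥ (diagonal d *ᵥ u)) k ^ 2
        / (δ + (diagonal d *ᵥ u) ⬝ᵥ vpdR B δ *ᵥ (diagonal d *ᵥ u))) ^ 2 ∂(uniformSphere n)
      ≤ 1/2*(2*40320*Real.exp (C/2)/(n:ℝ)^2 + (n:ℝ)^2*(s^4)⁻¹) := by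
  set R := vpdR B δ with hR
  have hC0 : 0 < C := by linarith
  have hRs : Rᵀ = R := vpdR_symm B δ
  have hdv : ∀ x y : Fin n → ℝ, (diagonal d *ᵥ x) ⬝ᵥ y = x ⬝ᵥ (diagonal d *ᵥ y) := by
    intro x y
    simp only [dotProduct, mulVec_diagonal]
    exact Finset.sum_congr rfl fun i _ => by ring
  have hdn : ∀ y : Fin n → ℝ, (diagonal d *ᵥ y) ⬝ᵥ (diagonal d *ᵥ y) ≤ C * (y ⬝ᵥ y) := by
    intro y
    simp only [dotProduct, mulVec_diagonal, Finset.mul_sum]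
    refine Finset.sum_le_sum fun i _ => ?_
    have := mul_le_mul_of_nonneg_right (hd i).2 (mul_self_nonneg (y i))
    linarith
  have hMv : ∀ x, (diagonal d * R * diagonal d) *ᵥ x = diagonal d *ᵥ (R *ᵥ (diagonal d *ᵥ x)) := by
    intro x
    simp [mulVec_mulVec, Matrix.mul_assoc]
  have hRx : ∀ x, (R *ᵥ x) k = (R *ᵥ Pi.single k 1) ⬝ᵥ x := by
    intro x
    rw [mulVec_single_one]
    simp only [mulVec, dotProduct]
    refine Finset.sum_congr rfl fun i _ => ?_
    congr 1
    exact congrFun (congrFun hRs i) k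
  have key := vpd_sphere hn (diagonal d * R * diagonal d)
    (by rw [transpose_mul, transpose_mul, hRs, diagonal_transpose, Matrix.mul_assoc]) C hC0
    (by
      intro x
      have e : x ⬝ᵥ (diagonal d * R * diagonal d) *ᵥ x
          = (diagonal d *ᵥ x) ⬝ᵥ R *ᵥ (diagonal d *ᵥ x) := by rw [hMv, hdv x]
      rw [e, hMv]
      exact (hdn _).trans (mul_le_mul_of_nonneg_left (vpdR_contr B hδ _) hC0.le))
    (diagonal d *ᵥ (R *ᵥ Pi.single k 1))
    (by
      refine (hdn _).trans ?_
      have := mul_le_mul_of_nonneg_left (vpdR_diag B hδ k).2.2 hC0.le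
      linarith)
    δ hδ s hs0
    (by
      have h1 : (diagonal d * R * diagonal d).trace = ∑ j, d j ^ 2 * R j j := by
        simp only [trace, Matrix.diag, mul_diagonal, diagonal_mul]
        exact Finset.sum_congr rfl fun i _ => by ring
      have h2 : C⁻¹ * R.trace ≤ ∑ j, d j ^ 2 * R j j := by
        simp only [trace, Matrix.diag, Finset.mul_sum]
        exact Finset.sum_le_sum fun j _ =>
          mul_le_mul_of_nonneg_right (hd j).1 (vpdR_diag B hδ j).1
      have h3 := vpdR_trace B hδ
      simp only [Fintype.card_fin] at h3
      have h4 := mul_le_mul_of_nonneg_left h3 (inv_nonneg.mpr hC0.le)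
      rw [h1]
      linarith)
  refine le_trans (le_of_eq ?_) key
  refine integral_congr_ae (Eventually.of_forall fun u => ?_)
  simp only []
  rw [hRx, hMv, hdv u, hdv (R *ᵥ Pi.single k 1) u]

lemma vpd_reg_var {n p : ℕ} (hn : 0 < n) (hpn : p ≤ n) (d : Fin n → ℝ) (C : ℝ) (hC : 1 ≤ C)
    (hd : ∀ k, C⁻¹ ≤ d k ^ 2 ∧ d k ^ 2 ≤ C) (i : ℕ) (δ : ℝ) (hδ : 0 < δ)
    (k : Fin n) (s : ℝ) (hs0 : 0 < s) (hs : s ≤ C⁻¹ * ((n : ℝ) - i) - 8 * C) :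
    varInt (sphereLaw n p) (fun ω => vpdR (rowMat (diagonal d) ω i) δ k k)
      ≤ n * (1/2*(2*40320*Real.exp (C/2)/(n:ℝ)^2 + (n:ℝ)^2*(s^4)⁻¹)) := by
  set K := 1/2*(2*40320*Real.exp (C/2)/(n:ℝ)^2 + (n:ℝ)^2*(s^4)⁻¹) with hK
  have hK0 : 0 ≤ K := by positivity
  set f : (Fin p → Fin n → ℝ) → ℝ := fun ω => vpdR (rowMat (diagonal d) ω i) δ k k with hf
  have hfm : Measurable f := vpd_R_meas _ i δ k k
  have hfb : ∀ ω, |f ω| ≤ 1 := fun ω => by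
    have := vpdR_diag (rowMat (diagonal d) ω i) hδ k
    rw [abs_le]; constructor <;> simp only [hf] <;> linarith [this.1, this.2.1]
  have hES := vpd_efron_stein (uniformSphere n) 0 1 p f hfm hfb
  unfold varInt sphereLaw
  refine hES.trans ?_
  have hterm : ∀ l : Fin p, ∫ ω, (f ω - f (Function.update ω l 0)) ^ 2
      ∂(Measure.pi fun _ : Fin p => uniformSphere n) ≤ K := by
    intro l
    by_cases hl : i ≤ l
    · have : ∀ ω, (f ω - f (Function.update ω l 0)) ^ 2 = 0 := by
        intro ω
        simp only [hf, vpd_row_update_ge _ i l hl]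
        simp
      simp only [this]
      simpa using hK0
    · push Not at hl
      have hum : Measurable (fun ω : Fin p → Fin n → ℝ => Function.update ω l (0 : Fin n → ℝ)) :=
        measurable_update_left
      have hgm : Measurable (fun ω => (f ω - f (Function.update ω l 0)) ^ 2) :=
        (hfm.sub (hfm.comp hum)).pow_const 2
      have hgb : ∀ ω, |(f ω - f (Function.update ω l 0)) ^ 2| ≤ 4 := by
        intro ω
        have h1 := abs_le.mp (hfb ω)
        have h2 := abs_le.mp (hfb (Function.update ω l 0))
        rw [abs_of_nonneg (sq_nonneg _)]
        nlinarith
      rw [vpd_resample_integral (uniformSphere n) l _ (vpd_int hgm 4 hgb)]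
      have hin : ∀ x : Fin p → Fin n → ℝ,
          ∫ t, (f (Function.update x l t) - f (Function.update (Function.update x l t) l 0)) ^ 2
            ∂(uniformSphere n) ≤ K := by
        intro x
        refine le_trans (le_of_eq ?_) (vpd_term hn d C hC hd
          (rowMat (diagonal d) (Function.update x l 0) i) δ hδ k s hs0 hs)
        refine integral_congr_ae (Eventually.of_forall fun t => ?_)
        simp only [hf, Function.update_idem]
        rw [vpdR_rank_one _ _ hδ _ (vpd_row_update_lt (diagonal d) i l hl x t) k]
        ring
      refine (integral_mono_of_nonneg (Eventually.of_forall fun x =>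
        integral_nonneg fun t => sq_nonneg _) (integrable_const K)
        (Eventually.of_forall hin)).trans ?_
      simp
  refine (Finset.sum_le_sum fun l _ => hterm l).trans ?_
  simp only [Finset.sum_const, Finset.card_univ, Fintype.card_fin, nsmul_eq_mul]
  exact mul_le_mul_of_nonneg_right (by exact_mod_cast hpn) hK0

lemma vpd_proj_var {n p : ℕ} (hn : 0 < n) (hpn : p ≤ n) (d : Fin n → ℝ) (C : ℝ) (hC : 1 ≤ C)
    (hd : ∀ k, C⁻¹ ≤ d k ^ 2 ∧ d k ^ 2 ≤ C) (i : ℕ) (hi : i ≤ p)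
    (k : Fin n) (s : ℝ) (hs0 : 0 < s) (hs : s ≤ C⁻¹ * ((n : ℝ) - i) - 8 * C) :
    varInt (sphereLaw n p) (fun ω => projMat (diagonal d) ω i k k)
      ≤ n * (1/2*(2*40320*Real.exp (C/2)/(n:ℝ)^2 + (n:ℝ)^2*(s^4)⁻¹)) := by
  have hdet : (diagonal d).det ≠ 0 := by
    rw [det_diagonal]
    refine Finset.prod_ne_zero_iff.mpr fun j _ h0 => ?_
    have := (hd j).1
    rw [h0] at this
    have h2 : 0 < C⁻¹ := inv_pos.mpr (by linarith)
    norm_num at this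
    linarith
  have hns := vpd_nonsing hpn (diagonal d) hdet i hi
  let δ : ℕ → ℝ := fun r => 1 / ((r : ℝ) + 1)
  have hδ : ∀ r, 0 < δ r := fun r => by positivity
  have hδ0 : Tendsto δ atTop (𝓝 0) := tendsto_one_div_add_atTop_nhds_zero_nat
  let F : ℕ → (Fin p → Fin n → ℝ) → ℝ := fun r ω => vpdR (rowMat (diagonal d) ω i) (δ r) k k
  have hFm : ∀ r, Measurable (F r) := fun r => vpd_R_meas _ i (δ r) k k
  have hFb : ∀ r ω, |F r ω| ≤ 1 := fun r ω => by
    have := vpdR_diag (rowMat (diagonal d) ω i) (hδ r) k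
    rw [abs_le]; constructor <;> simp only [F] <;> linarith [this.1, this.2.1]
  have hFl : ∀ᵐ ω ∂(sphereLaw n p), Tendsto (fun r => F r ω) atTop
      (𝓝 (projMat (diagonal d) ω i k k)) := by
    filter_upwards [hns] with ω h
    exact vpd_R_lim _ i k ω h δ hδ hδ0
  have hmean : Tendsto (fun r => ∫ ω, F r ω ∂(sphereLaw n p)) atTop
      (𝓝 (∫ ω, projMat (diagonal d) ω i k k ∂(sphereLaw n p))) :=
    tendsto_integral_of_dominated_convergence (fun _ => 1)
      (fun r => (hFm r).aestronglyMeasurable) (integrable_const _)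
      (fun r => Eventually.of_forall fun ω => hFb r ω) hFl
  have hmb : ∀ r, |∫ ω, F r ω ∂(sphereLaw n p)| ≤ 1 := by
    intro r
    have := norm_integral_le_of_norm_le_const (μ := sphereLaw n p) (f := F r) (C := 1)
      (Eventually.of_forall fun ω => hFb r ω)
    simpa using this
  have hvar : Tendsto (fun r => varInt (sphereLaw n p) (F r)) atTop
      (𝓝 (varInt (sphereLaw n p) (fun ω => projMat (diagonal d) ω i k k))) := by
    unfold varInt
    refine tendsto_integral_of_dominated_convergence (fun _ => 4)
      (fun r => (((hFm r).sub_const _).pow_const 2).aestronglyMeasurable) (integrable_const _)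
      (fun r => Eventually.of_forall fun ω => ?_) ?_
    · have h1 := abs_le.mp (hFb r ω)
      have h2 := abs_le.mp (hmb r)
      rw [Real.norm_eq_abs, abs_of_nonneg (sq_nonneg _)]
      nlinarith
    · filter_upwards [hFl] with ω h
      exact (h.sub hmean).pow 2
  exact le_of_tendsto' hvar fun r => vpd_reg_var hn hpn d C hC hd i (δ r) (hδ r) k s hs0 hs

/-- Under Assumption (A) and the bound `C⁻¹ ≤ A_{kk}² ≤ C`, the variances of
the diagonal entries of the projection matrices satisfy
`max_{1≤i≤p−1} max_{1≤k≤n} E[(p_{i,kk} − E[p_{i,kk}])²] = O(1/n)` as `n → ∞`. -/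
theorem variance_proj_diag (p : ℕ → ℕ) (γ : ℝ) (A : ∀ n, Matrix (Fin n) (Fin n) ℝ)
    (hp : ∀ n, p n ≤ n)
    (hdiag : ∀ n, (A n).IsDiag) (hpos : ∀ n k, 0 < A n k k)
    (htr : ∀ n, Matrix.trace (A n * A n) = (n : ℝ))
    (hγ : 0 < γ ∧ γ < 1)
    (hA : Tendsto (fun n => (p n : ℝ) / (n : ℝ)) atTop (𝓝 γ))
    (C : ℝ) (hC : 1 ≤ C)
    (hCb : ∀ n k, C⁻¹ ≤ (A n k k) ^ 2 ∧ (A n k k) ^ 2 ≤ C) :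
    ∃ c : ℝ, ∃ N : ℕ, ∀ n ≥ N, ∀ i : ℕ, 1 ≤ i → i < p n → ∀ k : Fin n,
      varInt (sphereLaw n (p n)) (fun ω => projMat (A n) ω i k k) ≤ c / (n : ℝ) := by
  have hC0 : 0 < C := by linarith
  have hCi : 0 < C⁻¹ := inv_pos.mpr hC0
  obtain ⟨hγ0, hγ1⟩ := hγ
  set τ : ℝ := C⁻¹ * ((1 - γ) / 4) with hτ
  have hτ0 : 0 < τ := mul_pos hCi (by linarith)
  have hev1 : ∀ᶠ n : ℕ in atTop, (p n : ℝ) / (n : ℝ) < (1 + γ) / 2 :=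
    hA.eventually_lt_const (by linarith)
  have hev2 : ∀ᶠ n : ℕ in atTop, 8 * C / τ ≤ (n : ℝ) :=
    tendsto_natCast_atTop_atTop.eventually_ge_atTop _
  obtain ⟨N, hN⟩ := eventually_atTop.mp (hev1.and (hev2.and (eventually_ge_atTop 1)))
  refine ⟨1/2*(2*40320*Real.exp (C/2) + (τ^4)⁻¹), N, fun n hn i _ hip k => ?_⟩
  obtain ⟨h1, h2, h3⟩ := hN n hn
  have hn0 : (0 : ℝ) < n := by exact_mod_cast h3
  have hAd : A n = diagonal (fun j => A n j j) := ((hdiag n).diagonal_diag).symm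
  rw [hAd]
  have hip' : (i : ℝ) ≤ p n := by exact_mod_cast hip.le
  rw [div_lt_iff₀ hn0] at h1
  rw [div_le_iff₀ hτ0] at h2
  have hs : τ * n ≤ C⁻¹ * ((n : ℝ) - i) - 8 * C := by
    have h4 : (1 - γ) / 2 * n ≤ (n : ℝ) - i := by linarith
    have h5 := mul_le_mul_of_nonneg_left h4 hCi.le
    have h6 : C⁻¹ * ((1 - γ) / 2 * n) = 2 * (τ * n) := by rw [hτ]; ring
    linarith
  refine (vpd_proj_var (by omega) (hp n) (fun j => A n j j) C hC (hCb n) i hip.le k (τ * n)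
    (by positivity) hs).trans (le_of_eq ?_)
  field_simp
end

section
/- Under Assumptions (A) and (B), the sum ∑_{i=0}^{p−1} (tr(Q_i²) − E[tr(Q_i²)]) converges to 0 in probability as n → ∞. -/
open MeasureTheory ProbabilityTheory Matrix Filter Topology

/-! ### Almost sure linear independence -/

lemma pi_ac (μ ν : Measure ℝ) [SigmaFinite μ] [SigmaFinite ν] (h : μ ≪ ν) (n : ℕ) :
    (Measure.pi fun _ : Fin n => μ) ≪ (Measure.pi fun _ : Fin n => ν) := by
  induction n with
  | zero =>
    rw [Measure.pi_of_empty, Measure.pi_of_empty]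
  | succ n ih =>
    have h1 := measurePreserving_piFinSuccAbove (fun _ : Fin (n+1) => μ) 0
    have h2 := measurePreserving_piFinSuccAbove (fun _ : Fin (n+1) => ν) 0
    have h3 := h.prod ih
    intro s hs
    have e1 := h1.symm.measure_preimage_equiv s
    have e2 := h2.symm.measure_preimage_equiv s
    rw [← e2] at hs
    rw [← e1]
    exact h3 hs

instance gaussianPi_prob (n : ℕ) : IsProbabilityMeasure (gaussianPi n) := by
  unfold gaussianPi; infer_instance

lemma measurable_normalize (n : ℕ) :
    Measurable fun x : Fin n → ℝ => (euclidNorm x)⁻¹ • x := by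
  unfold euclidNorm
  fun_prop

instance uniformSphere_prob (n : ℕ) : IsProbabilityMeasure (uniformSphere n) :=
  Measure.isProbabilityMeasure_map (measurable_normalize n).aemeasurable

instance sphereLaw_prob (n p : ℕ) : IsProbabilityMeasure (sphereLaw n p) := by
  unfold sphereLaw; infer_instance

lemma uniformSphere_submodule (n : ℕ) (V : Submodule ℝ (Fin n → ℝ)) (hV : V ≠ ⊤) :
    uniformSphere n V = 0 := by
  have hm : MeasurableSet (V : Set (Fin n → ℝ)) := V.closed_of_finiteDimensional.measurableSet
  rw [uniformSphere, Measure.map_apply (measurable_normalize n) hm]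
  have hsub : ((fun x : Fin n → ℝ => (euclidNorm x)⁻¹ • x) ⁻¹' (V : Set (Fin n → ℝ)))
      ⊆ (V : Set (Fin n → ℝ)) := by
    intro x hx
    simp only [Set.mem_preimage, SetLike.mem_coe] at hx ⊢
    by_cases h0 : euclidNorm x = 0
    · have : x = 0 := by
        unfold euclidNorm at h0
        rw [Real.sqrt_eq_zero (Finset.sum_nonneg fun j _ => sq_nonneg _)] at h0
        funext j
        have := (Finset.sum_eq_zero_iff_of_nonneg (fun j _ => sq_nonneg (x j))).1 h0 j
          (Finset.mem_univ j)
        simpa using this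
      rw [this]; exact V.zero_mem
    · have := V.smul_mem (euclidNorm x) hx
      rwa [smul_smul, mul_inv_cancel₀ h0, one_smul] at this
  refine measure_mono_null hsub ?_
  refine pi_ac _ volume (gaussianReal_absolutelyContinuous 0 one_ne_zero) n ?_
  exact Measure.addHaar_submodule _ V hV

lemma ae_linearIndependent (n : ℕ) (μ : Measure (Fin n → ℝ)) [IsProbabilityMeasure μ]
    (hμ : ∀ V : Submodule ℝ (Fin n → ℝ), V ≠ ⊤ → μ V = 0) (p : ℕ) (hp : p ≤ n) :
    ∀ᵐ ω ∂(Measure.pi fun _ : Fin p => μ), LinearIndependent ℝ ω := by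
  induction p with
  | zero => exact Filter.Eventually.of_forall fun ω => linearIndependent_empty_type
  | succ p ih =>
    have h1 := measurePreserving_piFinSuccAbove (fun _ : Fin (p+1) => μ) 0
    have ih' := ih (by omega)
    have hmeas : MeasurableSet {z : (Fin n → ℝ) × (Fin p → Fin n → ℝ) |
        LinearIndependent ℝ (Fin.cons z.1 z.2 : Fin (p+1) → Fin n → ℝ)} := by
      have : IsOpen {v : Fin (p+1) → Fin n → ℝ | LinearIndependent ℝ v} :=
        isOpen_setOfPred_linearIndependent
      refine (this.preimage (f := fun z : (Fin n → ℝ) × (Fin p → Fin n → ℝ) =>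
        (Fin.cons z.1 z.2 : Fin (p+1) → Fin n → ℝ)) ?_).measurableSet
      refine continuous_pi fun i => ?_
      refine Fin.cases ?_ (fun j => ?_) i
      · simpa using continuous_fst
      · simp only [Fin.cons_succ]; fun_prop
    have key : ∀ᵐ z ∂(μ.prod (Measure.pi fun _ : Fin p => μ)),
        LinearIndependent ℝ (Fin.cons z.1 z.2 : Fin (p+1) → Fin n → ℝ) := by
      rw [Measure.ae_prod_iff_ae_ae hmeas,
        Measure.ae_ae_comm (p := fun (x : Fin n → ℝ) (y : Fin p → Fin n → ℝ) =>
          LinearIndependent ℝ (Fin.cons x y : Fin (p+1) → Fin n → ℝ)) hmeas]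
      filter_upwards [ih'] with y hy
      have hV : Submodule.span ℝ (Set.range y) ≠ ⊤ := by
        intro htop
        have h2 := finrank_span_eq_card hy
        rw [htop, finrank_top] at h2
        simp at h2
        omega
      have := hμ _ hV
      filter_upwards [measure_eq_zero_iff_ae_notMem.1 this] with x hx
      exact linearIndependent_finCons.2 ⟨hy, hx⟩
    have := h1.quasiMeasurePreserving.ae key
    filter_upwards [this] with ω hω
    convert hω using 1
    funext i
    refine Fin.cases ?_ (fun j => ?_) i
    · rfl
    · rfl

/-! ### Matrix facts -/

lemma proj_facts {n i : ℕ} (B : Matrix (Fin i) (Fin n) ℝ) (hB : IsUnit (B * Bᵀ).det) :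
    (1 - Bᵀ * (B * Bᵀ)⁻¹ * B)ᵀ = (1 - Bᵀ * (B * Bᵀ)⁻¹ * B) ∧
    (1 - Bᵀ * (B * Bᵀ)⁻¹ * B) * (1 - Bᵀ * (B * Bᵀ)⁻¹ * B) = (1 - Bᵀ * (B * Bᵀ)⁻¹ * B) ∧
    trace (1 - Bᵀ * (B * Bᵀ)⁻¹ * B) = (n : ℝ) - i := by
  refine ⟨?_, ?_, ?_⟩
  · simp only [transpose_sub, transpose_one, transpose_mul, transpose_transpose,
      transpose_nonsing_inv, Matrix.mul_assoc]
  · have : (Bᵀ * (B * Bᵀ)⁻¹ * B) * (Bᵀ * (B * Bᵀ)⁻¹ * B) = Bᵀ * (B * Bᵀ)⁻¹ * B := by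
      calc _ = Bᵀ * (((B * Bᵀ)⁻¹ * (B * Bᵀ)) * (B * Bᵀ)⁻¹) * B := by
            simp only [Matrix.mul_assoc]
        _ = _ := by rw [nonsing_inv_mul _ hB, Matrix.one_mul]
    rw [sub_mul, mul_sub, mul_sub, this]
    simp
  · rw [trace_sub, trace_one, trace_mul_comm, ← Matrix.mul_assoc, mul_nonsing_inv _ hB, trace_one]
    simp

lemma isUnit_gram {n p : ℕ} (a : Fin n → ℝ) (ha : ∀ k, 0 < a k) (ω : Fin p → Fin n → ℝ)
    (hω : LinearIndependent ℝ ω) (i : ℕ) (hi : i ≤ p) :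
    IsUnit (rowMat (diagonal a) ω i * (rowMat (diagonal a) ω i)ᵀ).det := by
  have h1 : rowMat (diagonal a) ω i
      = (Matrix.of fun (k : Fin i) => ω (Fin.castLE hi k)) * diagonal a := by
    ext k j
    have : (k : ℕ) < p := by omega
    simp only [rowMat, uVec, of_apply, mulVec_diagonal, mul_diagonal, dif_pos this, mul_comm (a j)]
    rfl
  have h2 : Function.Injective (rowMat (diagonal a) ω i).vecMul := by
    rw [h1]
    have e1 : Function.Injective
        (Matrix.of fun (k : Fin i) => ω (Fin.castLE hi k)).vecMul := by
      rw [vecMul_injective_iff]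
      exact hω.comp _ (Fin.castLE_injective hi)
    intro x y hxy
    simp only [← vecMul_vecMul] at hxy
    apply e1
    funext j
    have := congrFun hxy j
    simp only [vecMul_diagonal] at this
    exact mul_right_cancel₀ (ha j).ne' this
  have h3 := PosDef.mul_conjTranspose_self _ h2
  rw [conjTranspose_eq_transpose_of_trivial] at h3
  exact h3.det_pos.ne'.isUnit

lemma proj_diag {n : ℕ} (P : Matrix (Fin n) (Fin n) ℝ) (h1 : Pᵀ = P) (h2 : P * P = P)
    (k : Fin n) : ∑ l, P k l ^ 2 = P k k := by
  conv_rhs => rw [← h2, mul_apply]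
  refine Finset.sum_congr rfl fun l _ => ?_
  have : P l k = P k l := congrFun (congrFun h1 k) l
  rw [this, sq]

lemma proj_diag_mem {n : ℕ} (P : Matrix (Fin n) (Fin n) ℝ) (h1 : Pᵀ = P) (h2 : P * P = P)
    (k : Fin n) : 0 ≤ P k k ∧ P k k ≤ 1 := by
  have h := proj_diag P h1 h2 k
  have h3 : P k k ^ 2 ≤ ∑ l, P k l ^ 2 :=
    Finset.single_le_sum (f := fun l => P k l ^ 2) (fun l _ => sq_nonneg _) (Finset.mem_univ k)
  constructor <;> nlinarith [sq_nonneg (P k k)]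

lemma trace_dev {n : ℕ} (a : Fin n → ℝ) (C : ℝ) (hC : ∀ k, a k ^ 2 ≤ C)
    (P : Matrix (Fin n) (Fin n) ℝ) (h1 : Pᵀ = P) (h2 : P * P = P) :
    |trace ((diagonal a * P * diagonal a) * (diagonal a * P * diagonal a)) - trace P|
      ≤ (C + 1) * ∑ k, |a k ^ 2 - 1| := by
  have hs : ∀ k l, P l k = P k l := fun k l => congrFun (congrFun h1 k) l
  have e1 : trace ((diagonal a * P * diagonal a) * (diagonal a * P * diagonal a))
      = ∑ k, ∑ l, a k ^ 2 * a l ^ 2 * P k l ^ 2 := by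
    simp only [trace, diag_apply, mul_apply (M := diagonal a * P * diagonal a), mul_diagonal,
      diagonal_mul]
    refine Finset.sum_congr rfl fun k _ => Finset.sum_congr rfl fun l _ => ?_
    rw [hs k l]; ring
  have e2 : trace P = ∑ k, ∑ l, P k l ^ 2 := by
    simp only [trace, diag_apply, proj_diag P h1 h2]
  rw [e1, e2, ← Finset.sum_sub_distrib]
  simp only [← Finset.sum_sub_distrib]
  have e3 : ∑ k, ∑ l, |a l ^ 2 - 1| * P k l ^ 2 = ∑ k, |a k ^ 2 - 1| * P k k := by
    rw [Finset.sum_comm]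
    refine Finset.sum_congr rfl fun k _ => ?_
    rw [← Finset.mul_sum, ← proj_diag P h1 h2 k]
    simp only [hs k]
  have e4 : ∑ k, ∑ l, |a k ^ 2 - 1| * P k l ^ 2 = ∑ k, |a k ^ 2 - 1| * P k k := by
    refine Finset.sum_congr rfl fun k _ => ?_
    rw [← Finset.mul_sum, ← proj_diag P h1 h2 k]
  calc |∑ k, ∑ l, (a k ^ 2 * a l ^ 2 * P k l ^ 2 - P k l ^ 2)|
      ≤ ∑ k, ∑ l, (C * (|a k ^ 2 - 1| * P k l ^ 2) + |a l ^ 2 - 1| * P k l ^ 2) := by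
        refine (Finset.abs_sum_le_sum_abs _ _).trans (Finset.sum_le_sum fun k _ => ?_)
        refine (Finset.abs_sum_le_sum_abs _ _).trans (Finset.sum_le_sum fun l _ => ?_)
        have : a k ^ 2 * a l ^ 2 * P k l ^ 2 - P k l ^ 2
          = a l ^ 2 * ((a k ^ 2 - 1) * P k l ^ 2) + (a l ^ 2 - 1) * P k l ^ 2 := by ring
        rw [this]
        refine (abs_add_le _ _).trans ?_
        rw [abs_mul, abs_mul, abs_mul, abs_of_nonneg (sq_nonneg (P k l)),
          abs_of_nonneg (sq_nonneg (a l))]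
        have := mul_le_mul_of_nonneg_right (hC l)
          (mul_nonneg (abs_nonneg (a k ^ 2 - 1)) (sq_nonneg (P k l)))
        linarith
    _ = (C + 1) * ∑ k, |a k ^ 2 - 1| * P k k := by
        simp only [Finset.sum_add_distrib, ← Finset.mul_sum]
        simp only [Finset.mul_sum] at *
        rw [e3]
        simp only [← Finset.mul_sum] at *
        rw [e4]; ring
    _ ≤ _ := by
        by_cases hn : Nonempty (Fin n)
        · have hC0 : 0 ≤ C := (sq_nonneg _).trans (hC hn.some)
          refine mul_le_mul_of_nonneg_left (Finset.sum_le_sum fun k _ => ?_) (by linarith)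
          exact mul_le_of_le_one_right (abs_nonneg _) (proj_diag_mem P h1 h2 k).2
        · rw [not_nonempty_iff] at hn
          simp

lemma measurable_projMat {n p : ℕ} (A : Matrix (Fin n) (Fin n) ℝ) (i : ℕ) (k l : Fin n) :
    Measurable fun ω : Fin p → Fin n → ℝ => projMat A ω i k l := by
  have hu : ∀ (j : ℕ), Measurable fun ω : Fin p → Fin n → ℝ => uVec ω j := by
    intro j
    unfold uVec
    split_ifs
    · fun_prop
    · fun_prop
  have hB : ∀ (a : Fin i) (b : Fin n), Measurable fun ω : Fin p → Fin n → ℝ => rowMat A ω i a b := by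
    intro a b
    simp only [rowMat, of_apply, mulVec, dotProduct]
    refine Finset.measurable_fun_sum _ fun j _ => ?_
    exact (measurable_pi_iff.1 (hu a) j).const_mul _
  have hG : ∀ a b, Measurable fun ω : Fin p → Fin n → ℝ =>
      (rowMat A ω i * (rowMat A ω i)ᵀ) a b := by
    intro a b
    simp only [mul_apply, transpose_apply]
    exact Finset.measurable_fun_sum _ fun j _ => (hB a j).mul (hB b j)
  have hdet : ∀ (m : ℕ) (M : (Fin p → Fin n → ℝ) → Matrix (Fin m) (Fin m) ℝ),
      (∀ a b, Measurable fun ω => M ω a b) → Measurable fun ω => (M ω).det := by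
    intro m M hM
    simp only [det_apply']
    exact Finset.measurable_fun_sum _ fun σ _ =>
      (Finset.measurable_fun_prod _ fun j _ => hM _ _).const_mul _
  have hI : ∀ a b, Measurable fun ω : Fin p → Fin n → ℝ =>
      (rowMat A ω i * (rowMat A ω i)ᵀ)⁻¹ a b := by
    intro a b
    simp only [inv_def, Matrix.smul_apply, smul_eq_mul, Ring.inverse_eq_inv', adjugate_apply]
    refine (hdet _ _ hG).inv.mul (hdet _ _ fun c d => ?_)
    simp only [updateRow_apply]
    split_ifs
    · fun_prop
    · exact hG _ _
  unfold projMat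
  have h1 : ∀ a b, Measurable fun ω : Fin p → Fin n → ℝ =>
      ((rowMat A ω i)ᵀ * (rowMat A ω i * (rowMat A ω i)ᵀ)⁻¹) a b := by
    intro a b
    simp only [mul_apply (M := (rowMat A _ i)ᵀ)]
    exact Finset.measurable_fun_sum _ fun j _ => (hB j a).mul (hI j b)
  have h2 : ∀ a b, Measurable fun ω : Fin p → Fin n → ℝ =>
      ((rowMat A ω i)ᵀ * (rowMat A ω i * (rowMat A ω i)ᵀ)⁻¹ * rowMat A ω i) a b := by
    intro a b
    simp only [mul_apply (N := rowMat A _ i)]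
    exact Finset.measurable_fun_sum _ fun j _ => (h1 a j).mul (hB j b)
  exact measurable_const.sub (h2 k l)

lemma ae_dev {Ω : Type*} [MeasurableSpace Ω] (μ : Measure Ω) [IsProbabilityMeasure μ]
    (g : Ω → ℝ) (hg : Measurable g) (c M : ℝ) (h : ∀ᵐ ω ∂μ, |g ω - c| ≤ M) :
    ∀ᵐ ω ∂μ, |g ω - ∫ ω', g ω' ∂μ| ≤ 2 * M := by
  have hi : Integrable (fun ω => g ω - c) μ :=
    Integrable.of_bound (hg.sub_const c).aestronglyMeasurable M h
  have hgi : Integrable g μ := by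
    refine (hi.add (integrable_const c)).congr (Filter.Eventually.of_forall fun ω => ?_)
    simp
  have h1 : |∫ ω', (g ω' - c) ∂μ| ≤ M := by
    have := norm_integral_le_of_norm_le_const (μ := μ) (f := fun ω => g ω - c) (C := M) h
    simpa using this
  rw [integral_sub hgi (integrable_const c)] at h1
  simp only [integral_const, probReal_univ, smul_eq_mul, one_mul] at h1
  filter_upwards [h] with ω hω
  rw [abs_le] at *
  constructor <;> linarith [hω.1, hω.2, h1.1, h1.2]

lemma Q_dev {n : ℕ} (p : ℕ) (hp : p ≤ n) (a : Fin n → ℝ) (ha : ∀ k, 0 < a k) (C : ℝ)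
    (hC : 0 < C) (hCb : ∀ k, C⁻¹ ≤ a k ^ 2 ∧ a k ^ 2 ≤ C) (i : ℕ) (hi : i < p) :
    ((n : ℝ) - i) / C ≤ Tstat n p (diagonal a) i ∧
    ∀ᵐ ω ∂(sphereLaw n p),
      |trace (Qmat (diagonal a) ω i * Qmat (diagonal a) ω i)
        - ∫ ω', trace (Qmat (diagonal a) ω' i * Qmat (diagonal a) ω' i) ∂(sphereLaw n p)|
      ≤ ((Tstat n p (diagonal a) i)⁻¹) ^ 2 * (2 * ((C + 1) * ∑ k, |a k ^ 2 - 1|)) := by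
  have hfacts : ∀ᵐ ω ∂(sphereLaw n p),
      (projMat (diagonal a) ω i)ᵀ = projMat (diagonal a) ω i ∧
      projMat (diagonal a) ω i * projMat (diagonal a) ω i = projMat (diagonal a) ω i ∧
      trace (projMat (diagonal a) ω i) = (n : ℝ) - i := by
    filter_upwards [ae_linearIndependent n (uniformSphere n) (uniformSphere_submodule n) p hp]
      with ω hω
    exact proj_facts _ (isUnit_gram a ha ω hω i hi.le)
  constructor
  · have hint : ∀ k, Integrable (fun ω => projMat (diagonal a) ω i k k) (sphereLaw n p) := by
      intro k
      refine Integrable.of_bound (measurable_projMat _ i k k).aestronglyMeasurable 1 ?_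
      filter_upwards [hfacts] with ω hω
      have := proj_diag_mem _ hω.1 hω.2.1 k
      rw [Real.norm_eq_abs, abs_le]
      constructor <;> linarith [this.1, this.2]
    have hnn : ∀ k, 0 ≤ ∫ ω, projMat (diagonal a) ω i k k ∂(sphereLaw n p) := by
      intro k
      refine integral_nonneg_of_ae ?_
      filter_upwards [hfacts] with ω hω
      exact (proj_diag_mem _ hω.1 hω.2.1 k).1
    have hsum : ∑ k, ∫ ω, projMat (diagonal a) ω i k k ∂(sphereLaw n p) = (n : ℝ) - i := by
      rw [← integral_finsetSum _ fun k _ => hint k]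
      have : (fun ω => ∑ k, projMat (diagonal a) ω i k k) =ᵐ[sphereLaw n p]
          fun _ => (n : ℝ) - i := by
        filter_upwards [hfacts] with ω hω
        exact hω.2.2
      rw [integral_congr_ae this]
      simp
    have hT : Tstat n p (diagonal a) i
        = ∑ k, a k ^ 2 * ∫ ω, projMat (diagonal a) ω i k k ∂(sphereLaw n p) := by
      unfold Tstat
      rw [diagonal_mul_diagonal]
      simp only [trace, diag_apply, diagonal_mul, meanProj, of_apply, sq]
    rw [hT, ← hsum, div_eq_inv_mul, Finset.mul_sum]
    exact Finset.sum_le_sum fun k _ => mul_le_mul_of_nonneg_right (hCb k).1 (hnn k)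
  · set t := (Tstat n p (diagonal a) i)⁻¹ with ht
    set g : (Fin p → Fin n → ℝ) → ℝ := fun ω =>
      trace ((diagonal a * projMat (diagonal a) ω i * diagonal a) *
        (diagonal a * projMat (diagonal a) ω i * diagonal a)) with hg
    have hQ : ∀ ω : Fin p → Fin n → ℝ,
        trace (Qmat (diagonal a) ω i * Qmat (diagonal a) ω i) = t ^ 2 * g ω := by
      intro ω
      simp only [Qmat, smul_mul_assoc, mul_smul_comm, trace_smul, smul_eq_mul, ← ht, hg]
      ring
    have hgm : Measurable g := by
      simp only [hg, trace, diag_apply, mul_apply (M := diagonal a * _ * diagonal a),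
        mul_diagonal, diagonal_mul]
      refine Finset.measurable_fun_sum _ fun k _ => Finset.measurable_fun_sum _ fun l _ => ?_
      exact (((measurable_projMat _ i k l).const_mul _).mul_const _).mul
        (((measurable_projMat _ i l k).const_mul _).mul_const _)
    have := ae_dev (sphereLaw n p) g hgm ((n : ℝ) - i) ((C + 1) * ∑ k, |a k ^ 2 - 1|) (by
      filter_upwards [hfacts] with ω hω
      rw [← hω.2.2]
      exact trace_dev a C (fun k => (hCb k).2) _ hω.1 hω.2.1)
    simp only [hQ, integral_const_mul]
    filter_upwards [this] with ω hω
    rw [← mul_sub, abs_mul, abs_of_nonneg (sq_nonneg t)]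
    exact mul_le_mul_of_nonneg_left hω (sq_nonneg t)

/-- Under Assumptions (A) and (B), the sum
`∑_{i=0}^{p−1} (tr(Q_i²) − E[tr(Q_i²)])` converges to `0` in probability as `n → ∞`. -/
theorem sum_traceQsq_centered_tendsto_zero (p : ℕ → ℕ) (γ : ℝ)
    (A : ∀ n, Matrix (Fin n) (Fin n) ℝ)
    (hp : ∀ n, p n ≤ n)
    (hdiag : ∀ n, (A n).IsDiag) (hpos : ∀ n k, 0 < A n k k)
    (htr : ∀ n, Matrix.trace (A n * A n) = (n : ℝ))
    (hγ : 0 < γ ∧ γ < 1)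
    (hA : Tendsto (fun n => (p n : ℝ) / (n : ℝ)) atTop (𝓝 γ))
    (C : ℝ) (hC : 1 ≤ C)
    (hCb : ∀ n k, C⁻¹ ≤ (A n k k) ^ 2 ∧ (A n k k) ^ 2 ≤ C)
    (hB2 : Tendsto
      (fun n => Matrix.trace
        ((A n * A n - (Matrix.trace (A n * A n) / (n : ℝ)) • (1 : Matrix (Fin n) (Fin n) ℝ)) ^ 2))
      atTop (𝓝 0)) :
    ∀ ε : ℝ, 0 < ε →
      Tendsto (fun n => sphereLaw n (p n)
          {ω | ε < |∑ i ∈ Finset.range (p n),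
            (Matrix.trace (Qmat (A n) ω i * Qmat (A n) ω i)
              - ∫ ω', Matrix.trace (Qmat (A n) ω' i * Qmat (A n) ω' i)
                  ∂(sphereLaw n (p n)))|})
        atTop (𝓝 0) := by
  intro ε hε
  set S : ℕ → ℝ := fun n => ∑ k, (A n k k ^ 2 - 1) ^ 2 with hS
  have hAd : ∀ n, A n = diagonal fun k => A n k k := fun n => ((hdiag n).diagonal_diag).symm
  have hS0 : Tendsto S atTop (𝓝 0) := by
    refine hB2.congr' ?_
    filter_upwards [eventually_gt_atTop 0] with n hn
    have hn' : (n : ℝ) ≠ 0 := by exact_mod_cast hn.ne'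
    rw [htr n, div_self hn', one_smul, hAd n, diagonal_mul_diagonal, ← diagonal_one,
      diagonal_sub, sq, diagonal_mul_diagonal, trace_diagonal]
    simp only [hS, diagonal_apply_eq]
    exact Finset.sum_congr rfl fun k _ => by ring
  set c : ℝ := (1 - γ) / 2 with hc
  have hc0 : 0 < c := by have := hγ.2; rw [hc]; linarith
  set K : ℝ := 2 * (C + 1) * (C / c) ^ 2 with hK
  have hK0 : 0 < K := by
    have : 0 < C / c := div_pos (by linarith) hc0
    rw [hK]; positivity
  have hev1 : ∀ᶠ n in atTop, (p n : ℝ) / n < 1 - c :=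
    hA.eventually (gt_mem_nhds (by have := hγ.2; rw [hc]; linarith))
  have hev2 : ∀ᶠ n in atTop, S n < (ε / K) ^ 2 :=
    hS0.eventually (gt_mem_nhds (by positivity))
  refine tendsto_const_nhds.congr' ?_
  filter_upwards [hev1, hev2, eventually_gt_atTop 0] with n h1 h2 hn
  have hn' : (0 : ℝ) < n := by exact_mod_cast hn
  have hn1 : (1 : ℝ) ≤ n := by exact_mod_cast hn
  symm
  have hgap : c * n ≤ (n : ℝ) - p n := by
    rw [div_lt_iff₀ hn'] at h1; linarith
  -- Cauchy–Schwarz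
  set M : ℝ := ∑ k, |A n k k ^ 2 - 1| with hM
  have hM0 : 0 ≤ M := Finset.sum_nonneg fun k _ => abs_nonneg _
  have hMsq : M ^ 2 ≤ n * S n := by
    have := sq_sum_le_card_mul_sum_sq (s := Finset.univ) (f := fun k => |A n k k ^ 2 - 1|)
    simpa [hM, hS, sq_abs] using this
  have hMle : M ≤ n * (ε / K) := by
    have hek : 0 < ε / K := by positivity
    refine le_of_sq_le_sq ?_ (by positivity)
    calc M ^ 2 ≤ n * S n := hMsq
      _ ≤ n * (ε / K) ^ 2 := by gcongr
      _ ≤ (n * n) * (ε / K) ^ 2 := by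
          refine mul_le_mul_of_nonneg_right ?_ (by positivity)
          nlinarith
      _ = _ := by ring
  have hae : ∀ᵐ ω ∂(sphereLaw n (p n)), ∀ i ∈ Finset.range (p n),
      |trace (Qmat (A n) ω i * Qmat (A n) ω i)
        - ∫ ω', trace (Qmat (A n) ω' i * Qmat (A n) ω' i) ∂(sphereLaw n (p n))|
      ≤ (C / (c * n)) ^ 2 * (2 * ((C + 1) * M)) := by
    rw [Filter.eventually_all_finset]
    intro i hi
    rw [Finset.mem_range] at hi
    have hdev := Q_dev (p n) (hp n) (fun k => A n k k) (hpos n) C (by linarith)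
      (hCb n) i hi
    rw [← hAd n] at hdev
    obtain ⟨hT, hdev⟩ := hdev
    filter_upwards [hdev] with ω hω
    refine hω.trans (mul_le_mul_of_nonneg_right ?_ (by positivity))
    have hi' : (i : ℝ) ≤ p n := by exact_mod_cast hi.le
    have hcn : 0 < c * n := by positivity
    have hT' : c * n / C ≤ Tstat n (p n) (A n) i := by
      refine le_trans ?_ hT
      gcongr
      linarith
    have hq : 0 < c * n / C := by positivity
    have : (Tstat n (p n) (A n) i)⁻¹ ≤ C / (c * n) := by
      rw [← inv_div]
      exact inv_anti₀ hq hT'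
    have h0 : 0 ≤ (Tstat n (p n) (A n) i)⁻¹ := inv_nonneg.2 (hq.le.trans hT')
    gcongr
  rw [measure_eq_zero_iff_ae_notMem]
  filter_upwards [hae] with ω hω
  simp only [Set.mem_setOf_eq, not_lt]
  refine (Finset.abs_sum_le_sum_abs _ _).trans ((Finset.sum_le_sum hω).trans ?_)
  rw [Finset.sum_const, Finset.card_range, nsmul_eq_mul]
  have hpn : (p n : ℝ) ≤ n := by exact_mod_cast hp n
  calc (p n : ℝ) * ((C / (c * n)) ^ 2 * (2 * ((C + 1) * M)))
      ≤ n * ((C / (c * n)) ^ 2 * (2 * ((C + 1) * (n * (ε / K))))) := by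
        gcongr
    _ = ε := by
        rw [hK]
        have : C ≠ 0 := by linarith
        have : C + 1 ≠ 0 := by linarith
        field_simp
end
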